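/- arXiv:1906.03719 — 2 statements merged into one kernel-verified Lean document; each statement's English description precedes it below -/
import Mathlib

section
/- Let C be an isotropic convex body in ℝⁿ and K a centrally symmetric convex body in ℝⁿ. There is an absolute constant c₁ > 0 such that for every s ≥ 1 and every t = (t₁,…,t_s) ∈ ℝˢ, c₁ L_C R(K°) ‖t‖₂ ≤ ∫_C⋯∫_C ‖∑_{j=1}^s t_j x_j‖_K dx₁⋯dx_s ≤ √n · L_C R(K°) ‖t‖₂. -/
open MeasureTheory Real
open scoped ENNReal RealInnerProductSpace

noncomputable section

/-- A convex body: compact, convex, with non-empty interior. -/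
def IsConvexBody {n : ℕ} (C : Set (EuclideanSpace ℝ (Fin n))) : Prop :=
  Convex ℝ C ∧ IsCompact C ∧ (interior C).Nonempty

/-- A centrally symmetric convex body. -/
def IsSymmConvexBody {n : ℕ} (C : Set (EuclideanSpace ℝ (Fin n))) : Prop :=
  Convex ℝ C ∧ IsCompact C ∧ (interior C).Nonempty ∧ C = -C

/-- `C` is isotropic with isotropic constant `L`: it has volume 1, barycenter at the
origin, and `∫_C ⟨x,ξ⟩² dx = L²` for every unit vector `ξ`. -/
def IsIsotropic {n : ℕ} (C : Set (EuclideanSpace ℝ (Fin n))) (L : ℝ) : Prop :=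
  volume C = 1 ∧ (∫ x in C, x) = 0 ∧ 0 < L ∧
    ∀ ξ : EuclideanSpace ℝ (Fin n), ‖ξ‖ = 1 → (∫ x in C, ⟪x, ξ⟫ ^ 2) = L ^ 2

/-- The Euclidean norm of `t ∈ ℝˢ`. -/
def euclNorm {s : ℕ} (t : Fin s → ℝ) : ℝ := Real.sqrt (∑ j, t j ^ 2)

theorem volume_add_le_two_mul_volume_of_compact {A B M : Set ℝ}
    (hA : IsCompact A) (hB : IsCompact B) (hA0 : A.Nonempty) (hB0 : B.Nonempty)
    (h : ∀ x ∈ A, ∀ y ∈ B, (x + y) / 2 ∈ M) :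
    volume A + volume B ≤ 2 * volume M := by
  obtain ⟨a, ha, hamax⟩ := hA.exists_isGreatest hA0
  obtain ⟨b, hb, hbmin⟩ := hB.exists_isLeast hB0
  have h2 : 2 * volume M = volume ((fun x : ℝ => 2⁻¹ * x) ⁻¹' M) := by
    rw [Real.volume_preimage_mul_left (by norm_num)]
    norm_num
  have h3 : volume A = volume ((fun x : ℝ => x + (-b)) ⁻¹' A) := by
    rw [measure_preimage_add_right]
  have h4 : volume B = volume ((fun x : ℝ => x + (-a)) ⁻¹' B) := by
    rw [measure_preimage_add_right]
  have hmeas : MeasurableSet ((fun x : ℝ => x + (-a)) ⁻¹' B) :=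
    (measurable_add_const _) hB.measurableSet
  rw [h2, h3, h4, ← measure_union₀ hmeas.nullMeasurableSet]
  · refine measure_mono ?_
    rintro x (hx | hx)
    · have := h _ hx b hb
      simp only [Set.mem_preimage]
      convert this using 1
      ring
    · have := h a ha _ hx
      simp only [Set.mem_preimage]
      convert this using 1
      ring
  · refine measure_mono_null (t := {a + b}) ?_ (by simp)
    rintro x ⟨hx, hx'⟩
    have h5 := hamax hx
    have h6 := hbmin hx'
    simp only [Set.mem_singleton_iff]
    linarith

theorem volume_add_le_two_mul_volume {A B M : Set ℝ} (hA : MeasurableSet A)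
    (hB : MeasurableSet B) (hA0 : A.Nonempty) (hB0 : B.Nonempty)
    (h : ∀ x ∈ A, ∀ y ∈ B, (x + y) / 2 ∈ M) :
    volume A + volume B ≤ 2 * volume M := by
  obtain ⟨a, ha⟩ := hA0
  obtain ⟨b, hb⟩ := hB0
  rw [hA.measure_eq_iSup_isCompact, hB.measure_eq_iSup_isCompact]
  simp_rw [iSup_and']
  refine ENNReal.biSup_add_biSup_le' ⟨∅, by simp⟩ ⟨∅, by simp⟩ fun A' hA' B' hB' => ?_
  refine le_trans (add_le_add (measure_mono (Set.subset_insert a A'))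
    (measure_mono (Set.subset_insert b B'))) ?_
  exact volume_add_le_two_mul_volume_of_compact (hA'.2.insert a) (hB'.2.insert b)
    (Set.insert_nonempty _ _) (Set.insert_nonempty _ _) fun x hx y hy =>
      h x (Set.insert_subset ha hA'.1 hx) y (Set.insert_subset hb hB'.1 hy)

theorem lintegral_add_le_of_normalized {f g h : ℝ → ℝ} (hf : Measurable f) (hg : Measurable g)
    (hh : Measurable h) (hf0 : ∀ x, 0 ≤ f x) (hg0 : ∀ x, 0 ≤ g x) (hh0 : ∀ x, 0 ≤ h x)
    (hf1 : ∀ x, f x ≤ 1) (hg1 : ∀ x, g x ≤ 1)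
    (hf2 : ∀ t < 1, ∃ x, t < f x) (hg2 : ∀ t < 1, ∃ x, t < g x)
    (hfgh : ∀ x y, f x * g y ≤ h ((x + y) / 2) ^ 2) :
    (∫⁻ x, ENNReal.ofReal (f x)) + ∫⁻ x, ENNReal.ofReal (g x)
      ≤ 2 * ∫⁻ x, ENNReal.ofReal (h x) := by
  rw [lintegral_eq_lintegral_meas_lt _ (.of_forall hf0) hf.aemeasurable,
    lintegral_eq_lintegral_meas_lt _ (.of_forall hg0) hg.aemeasurable,
    lintegral_eq_lintegral_meas_lt _ (.of_forall hh0) hh.aemeasurable,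
    ← lintegral_const_mul' _ _ (by simp), ← lintegral_add_left' ?_]
  · refine setLIntegral_mono' measurableSet_Ioi fun t (ht : 0 < t) => ?_
    by_cases ht1 : t < 1
    · refine volume_add_le_two_mul_volume (measurableSet_lt measurable_const hf)
        (measurableSet_lt measurable_const hg) (hf2 t ht1) (hg2 t ht1) fun x hx y hy => ?_
      simp only [Set.mem_ofPred_eq] at hx hy ⊢
      refine lt_of_pow_lt_pow_left₀ 2 (hh0 _) (lt_of_lt_of_le ?_ (hfgh x y))
      nlinarith
    · have e1 : {a | t < f a} = ∅ := by
        ext x; simp; linarith [hf1 x]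
      have e2 : {a | t < g a} = ∅ := by
        ext x; simp; linarith [hg1 x]
      simp [e1, e2]
  · exact (Antitone.measurable fun s t hst => measure_mono fun x (hx : t < f x) =>
      lt_of_le_of_lt hst hx).aemeasurable

theorem ENNReal.mul_le_sq_of_add_le_two_mul {a b c : ℝ≥0∞} (h : a + b ≤ 2 * c) :
    a * b ≤ c ^ 2 := by
  by_cases hc : c = ∞
  · simp [hc]
  have hab : a + b ≠ ∞ := ne_top_of_le_ne_top (ENNReal.mul_ne_top (by simp) hc) h
  have ha : a ≠ ∞ := fun h => hab (by simp [h])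
  have hb : b ≠ ∞ := fun h => hab (by simp [h])
  lift a to NNReal using ha
  lift b to NNReal using hb
  lift c to NNReal using hc
  norm_cast at h ⊢
  have h' : (a : ℝ) + b ≤ 2 * c := by exact_mod_cast h
  have : (a : ℝ) * b ≤ c ^ 2 := by
    nlinarith [sq_nonneg ((a : ℝ) - b), a.2, b.2, c.2, NNReal.coe_nonneg a, NNReal.coe_nonneg b]
  exact_mod_cast this

theorem lintegral_mul_le_sq_of_bounded {f g h : ℝ → ℝ} (hf : Measurable f) (hg : Measurable g)
    (hh : Measurable h) (hf0 : ∀ x, 0 ≤ f x) (hg0 : ∀ x, 0 ≤ g x) (hh0 : ∀ x, 0 ≤ h x)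
    {N : ℝ} (hf1 : ∀ x, f x ≤ N) (hg1 : ∀ x, g x ≤ N)
    (hfgh : ∀ x y, f x * g y ≤ h ((x + y) / 2) ^ 2) :
    (∫⁻ x, ENNReal.ofReal (f x)) * ∫⁻ x, ENNReal.ofReal (g x)
      ≤ (∫⁻ x, ENNReal.ofReal (h x)) ^ 2 := by
  have hfb : BddAbove (Set.range f) := ⟨N, by rintro _ ⟨x, rfl⟩; exact hf1 x⟩
  have hgb : BddAbove (Set.range g) := ⟨N, by rintro _ ⟨x, rfl⟩; exact hg1 x⟩
  set F := ⨆ x, f x with hF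
  set G := ⨆ x, g x with hG
  have hfF : ∀ x, f x ≤ F := le_ciSup hfb
  have hgG : ∀ x, g x ≤ G := le_ciSup hgb
  rcases (le_trans (hf0 0) (hfF 0)).eq_or_lt with hF0 | hF0
  · have : ∀ x, ENNReal.ofReal (f x) = 0 := fun x => ENNReal.ofReal_of_nonpos (hF0 ▸ hfF x)
    simp [this]
  rcases (le_trans (hg0 0) (hgG 0)).eq_or_lt with hG0 | hG0
  · have : ∀ x, ENNReal.ofReal (g x) = 0 := fun x => ENNReal.ofReal_of_nonpos (hG0 ▸ hgG x)
    simp [this]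
  set H := √(F * G) with hH
  have hHpos : 0 < H := Real.sqrt_pos.2 (mul_pos hF0 hG0)
  have hH2 : H ^ 2 = F * G := Real.sq_sqrt (mul_pos hF0 hG0).le
  have scale : ∀ (k : ℝ → ℝ) (c : ℝ), 0 < c →
      ∫⁻ x, ENNReal.ofReal (k x) = ENNReal.ofReal c * ∫⁻ x, ENNReal.ofReal (k x / c) := by
    intro k c hc
    rw [← lintegral_const_mul' _ _ (by simp)]
    refine lintegral_congr fun x => ?_
    rw [← ENNReal.ofReal_mul hc.le, mul_div_cancel₀ _ hc.ne']
  have key := ENNReal.mul_le_sq_of_add_le_two_mul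
    (lintegral_add_le_of_normalized (hf.div_const F) (hg.div_const G) (hh.div_const H)
      (fun x => div_nonneg (hf0 x) hF0.le) (fun x => div_nonneg (hg0 x) hG0.le)
      (fun x => div_nonneg (hh0 x) hHpos.le)
      (fun x => (div_le_one hF0).2 (hfF x)) (fun x => (div_le_one hG0).2 (hgG x))
      (fun t ht => by
        obtain ⟨x, hx⟩ := exists_lt_of_lt_ciSup (f := f) (show t * F < F by nlinarith)
        exact ⟨x, (lt_div_iff₀ hF0).2 hx⟩)
      (fun t ht => by
        obtain ⟨x, hx⟩ := exists_lt_of_lt_ciSup (f := g) (show t * G < G by nlinarith)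
        exact ⟨x, (lt_div_iff₀ hG0).2 hx⟩)
      (fun x y => by
        rw [div_pow, hH2, div_mul_div_comm]
        exact div_le_div_of_nonneg_right (hfgh x y) (mul_pos hF0 hG0).le))
  rw [scale f F hF0, scale g G hG0, scale h H hHpos, mul_pow, mul_mul_mul_comm,
    ← ENNReal.ofReal_mul hF0.le, ← ENNReal.ofReal_pow hHpos.le, hH2]
  gcongr

/-- The midpoint case of the Prékopa–Leindler inequality for the measure `μ`. -/
def MidpointPrekopaLeindler {E : Type*} [AddCommGroup E] [Module ℝ E] [MeasurableSpace E]
    (μ : Measure E) : Prop :=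
  ∀ f g h : E → ℝ≥0∞, Measurable f → Measurable g → Measurable h →
    (∀ x y, f x * g y ≤ h ((1 / 2 : ℝ) • (x + y)) ^ 2) →
    (∫⁻ x, f x ∂μ) * ∫⁻ x, g x ∂μ ≤ (∫⁻ x, h x ∂μ) ^ 2

theorem midpointPrekopaLeindler_real : MidpointPrekopaLeindler (volume : Measure ℝ) := by
  intro f g h hf hg hh hfgh
  have trunc : ∀ k : ℝ → ℝ≥0∞, Measurable k →
      ∫⁻ x, k x = ⨆ n : ℕ, ∫⁻ x, min (k x) n := by
    intro k hk
    rw [← lintegral_iSup (fun n => hk.min measurable_const)]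
    · refine lintegral_congr fun x => ?_
      exact (by rw [← inf_iSup_eq, ENNReal.iSup_natCast, inf_top_eq] :
        k x = ⨆ n : ℕ, k x ⊓ (n : ℝ≥0∞))
    · intro m n hmn x
      exact min_le_min le_rfl (by exact_mod_cast hmn)
  have key : ∀ n : ℕ, (∫⁻ x, min (f x) n) * ∫⁻ x, min (g x) n ≤ (∫⁻ x, h x) ^ 2 := by
    intro n
    have e : ∀ (k : ℝ → ℝ≥0∞) x, ENNReal.ofReal (min (k x) n).toReal = min (k x) n := fun k x =>
      ENNReal.ofReal_toReal (ne_top_of_le_ne_top (by simp) (min_le_right _ _))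
    have b : ∀ (k : ℝ → ℝ≥0∞) x, (min (k x) n).toReal ≤ n := fun k x => by
      simpa using ENNReal.toReal_mono (by simp) (min_le_right (k x) (n : ℝ≥0∞))
    have := lintegral_mul_le_sq_of_bounded (hf.min measurable_const).ennreal_toReal
      (hg.min measurable_const).ennreal_toReal (hh.min (measurable_const (a := (n : ℝ≥0∞)))).ennreal_toReal
      (fun _ => ENNReal.toReal_nonneg) (fun _ => ENNReal.toReal_nonneg)
      (fun _ => ENNReal.toReal_nonneg) (b f) (b g) (fun x y => by
        rw [← ENNReal.toReal_mul, ← ENNReal.toReal_pow]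
        refine ENNReal.toReal_mono (ENNReal.pow_ne_top
          (ne_top_of_le_ne_top (by simp) (min_le_right _ _))) ?_
        rcases le_total (h ((x + y) / 2)) n with h1 | h1
        · rw [min_eq_left h1]
          refine le_trans (mul_le_mul' (min_le_left _ _) (min_le_left _ _)) ?_
          simpa [div_eq_inv_mul] using hfgh x y
        · rw [min_eq_right h1, sq]
          exact mul_le_mul' (min_le_right _ _) (min_le_right _ _))
    simp only [e] at this
    refine this.trans ?_
    gcongr
    exact min_le_left _ _
  rw [trunc f hf, trunc g hg, ENNReal.iSup_mul]
  refine iSup_le fun m => ?_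
  rw [ENNReal.mul_iSup]
  refine iSup_le fun n => le_trans (mul_le_mul' ?_ ?_) (key (max m n))
  all_goals
    refine lintegral_mono fun x => min_le_min le_rfl ?_
    simp

theorem MidpointPrekopaLeindler.prod {E F : Type*} [AddCommGroup E] [Module ℝ E]
    [MeasurableSpace E] [AddCommGroup F] [Module ℝ F] [MeasurableSpace F]
    {μ : Measure E} {ν : Measure F} [SFinite μ] [SFinite ν] (hμ : MidpointPrekopaLeindler μ)
    (hν : MidpointPrekopaLeindler ν) : MidpointPrekopaLeindler (μ.prod ν) := by
  intro f g h hf hg hh hfgh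
  rw [lintegral_prod _ hf.aemeasurable, lintegral_prod _ hg.aemeasurable,
    lintegral_prod _ hh.aemeasurable]
  refine hμ _ _ _ hf.lintegral_prod_right' hg.lintegral_prod_right' hh.lintegral_prod_right'
    fun x y => ?_
  exact hν _ _ _ (hf.comp measurable_prodMk_left) (hg.comp measurable_prodMk_left)
    (hh.comp measurable_prodMk_left) fun x' y' => hfgh (x, x') (y, y')

theorem MidpointPrekopaLeindler.of_measurePreserving {E F : Type*} [AddCommGroup E] [Module ℝ E]
    [MeasurableSpace E] [AddCommGroup F] [Module ℝ F] [MeasurableSpace F]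
    {μ : Measure E} {ν : Measure F} (hμ : MidpointPrekopaLeindler μ) (e : E →ₗ[ℝ] F)
    (he : MeasurePreserving e μ ν) : MidpointPrekopaLeindler ν := by
  intro f g h hf hg hh hfgh
  rw [← he.lintegral_comp hf, ← he.lintegral_comp hg, ← he.lintegral_comp hh]
  refine hμ _ _ _ (hf.comp he.measurable) (hg.comp he.measurable) (hh.comp he.measurable)
    fun x y => ?_
  simpa using hfgh (e x) (e y)

theorem midpointPrekopaLeindler_pi (n : ℕ) :
    MidpointPrekopaLeindler (volume : Measure (Fin n → ℝ)) := by
  induction n with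
  | zero =>
    intro f g h hf hg hh hfgh
    rw [volume_pi, Measure.pi_of_empty _ 0, lintegral_dirac, lintegral_dirac, lintegral_dirac]
    simpa using hfgh 0 0
  | succ n ih =>
    refine (midpointPrekopaLeindler_real.prod ih).of_measurePreserving
      (Fin.consLinearEquiv ℝ (fun _ => ℝ)).toLinearMap ?_
    convert! (volume_preserving_piFinSuccAbove (fun _ : Fin (n + 1) => ℝ) 0).symm using 1
    ext x : 1
    exact (Fin.insertNth_zero' x.1 x.2).symm

theorem midpointPrekopaLeindler_euclideanSpace (n : ℕ) :
    MidpointPrekopaLeindler (volume : Measure (EuclideanSpace ℝ (Fin n))) :=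
  (midpointPrekopaLeindler_pi n).of_measurePreserving
    (WithLp.linearEquiv 2 ℝ (Fin n → ℝ)).symm.toLinearMap (PiLp.volume_preserving_toLp (Fin n))

theorem volume_mul_le_sq {n : ℕ} {A B M : Set (EuclideanSpace ℝ (Fin n))}
    (hA : MeasurableSet A) (hB : MeasurableSet B) (hM : MeasurableSet M)
    (h : ∀ x ∈ A, ∀ y ∈ B, (1 / 2 : ℝ) • (x + y) ∈ M) :
    volume A * volume B ≤ volume M ^ 2 := by
  have := midpointPrekopaLeindler_euclideanSpace n (A.indicator 1) (B.indicator 1) (M.indicator 1)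
    (measurable_one.indicator hA) (measurable_one.indicator hB) (measurable_one.indicator hM)
    fun x y => by
      by_cases hx : x ∈ A
      · by_cases hy : y ∈ B
        · rw [Set.indicator_of_mem (h x hx y hy), Set.indicator_of_mem hx, Set.indicator_of_mem hy]
          simp
        · simp [hy]
      · simp [hx]
  simpa [lintegral_indicator_one, hA, hB, hM] using this

theorem integral_pow_four_le_of_tail {Ω : Type*} [MeasurableSpace Ω] {μ : Measure Ω}
    [IsProbabilityMeasure μ] {f : Ω → ℝ} (hf : Measurable f)
    (hf2 : Integrable (fun ω => f ω ^ 2) μ) (hf4 : Integrable (fun ω => f ω ^ 4) μ)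
    (htail : ∀ a > 0, μ {ω | 3 * a < |f ω|} * μ {ω | |f ω| ≤ a} ≤ μ {ω | a < |f ω|} ^ 2) :
    ∫ ω, f ω ^ 4 ∂μ ≤ 162 * 18 ^ 4 * (∫ ω, f ω ^ 2 ∂μ) ^ 2 := by
  set v := ∫ ω, f ω ^ 2 ∂μ with hv
  have hv0 : 0 ≤ v := integral_nonneg fun ω => sq_nonneg _
  rcases hv0.eq_or_lt with hv1 | hv1
  · have h0 : (fun ω => f ω ^ 2) =ᵐ[μ] 0 :=
      (integral_eq_zero_iff_of_nonneg (fun ω => sq_nonneg _) hf2).1 (hv.symm.trans hv1.symm)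
    have h1 : (fun ω => f ω ^ 4) =ᵐ[μ] 0 := by
      filter_upwards [h0] with ω hω
      have : f ω ^ 2 = 0 := hω
      simp only [Pi.zero_apply]
      rw [show f ω ^ 4 = (f ω ^ 2) ^ 2 by ring, this]; norm_num
    rw [integral_congr_ae h1]
    simp only [Pi.zero_apply, integral_zero]
    positivity
  set σ := √v with hσ
  have hσ0 : 0 < σ := Real.sqrt_pos.2 hv1
  have hσ2 : σ ^ 2 = v := Real.sq_sqrt hv0
  have tail : ∀ t ∈ Set.Ioi (0 : ℝ), μ {ω | t < |f ω| / 3} ≤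
      μ {_ω | t < 18 * σ} + ENNReal.ofReal (1 / 162) * μ {ω | t < |f ω|} := by
    intro t (ht : 0 < t)
    by_cases hts : t < 18 * σ
    · simp only [hts]
      refine le_trans prob_le_one ?_
      simp
    · refine le_trans ?_ le_add_self
      have hch := mul_meas_ge_le_integral_of_nonneg (.of_forall fun ω => sq_nonneg (f ω)) hf2
        (t ^ 2)
      have hsub : μ.real {ω | t < |f ω|} ≤ μ.real {ω | t ^ 2 ≤ f ω ^ 2} := by
        refine measureReal_mono fun ω (hω : t < |f ω|) => ?_
        simp only [Set.mem_ofPred_eq]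
        rw [← sq_abs (f ω)]
        gcongr
      have hcompl : μ.real {ω | |f ω| ≤ t} = 1 - μ.real {ω | t < |f ω|} := by
        rw [← probReal_compl_eq_one_sub (measurableSet_lt measurable_const hf.abs)]
        congr 1
        ext ω
        simp
      have h3 := ENNReal.toReal_mono (by simp) (htail t ht)
      rw [ENNReal.toReal_mul, ENNReal.toReal_pow] at h3
      change μ.real _ * μ.real _ ≤ μ.real _ ^ 2 at h3
      rw [hcompl] at h3
      have h4 : {ω | t < |f ω| / 3} = {ω | 3 * t < |f ω|} := by
        ext ω
        simp only [Set.mem_ofPred_eq]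
        constructor <;> intro h <;> linarith
      rw [h4]
      set p := μ.real {ω | t < |f ω|} with hp
      set r := μ.real {ω | 3 * t < |f ω|} with hr
      have hp0 : 0 ≤ p := measureReal_nonneg
      have hr0 : 0 ≤ r := measureReal_nonneg
      have hp1 : p ≤ 1 / 324 := by
        have h5 : t ^ 2 * p ≤ σ ^ 2 := by
          rw [hσ2]
          exact le_trans (by gcongr) hch
        have h6 : 324 * σ ^ 2 ≤ t ^ 2 := by
          push Not at hts
          nlinarith
        have h7 : 324 * σ ^ 2 * p ≤ σ ^ 2 := le_trans (by gcongr) h5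
        by_contra! h8
        nlinarith [pow_pos hσ0 2]
      have hrp : r ≤ 1 / 162 * p := by nlinarith
      rw [← ofReal_measureReal, ← ofReal_measureReal, ← ENNReal.ofReal_mul (by norm_num)]
      exact ENNReal.ofReal_le_ofReal hrp
  have hmeas : Measurable fun t : ℝ => ENNReal.ofReal (t ^ ((4 : ℝ) - 1)) := by fun_prop
  have hcmp : ∫⁻ ω, ENNReal.ofReal ((|f ω| / 3) ^ (4 : ℝ)) ∂μ ≤
      ∫⁻ _ω, ENNReal.ofReal ((18 * σ) ^ (4 : ℝ)) ∂μ +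
        ENNReal.ofReal (1 / 162) * ∫⁻ ω, ENNReal.ofReal (|f ω| ^ (4 : ℝ)) ∂μ := by
    rw [lintegral_rpow_eq_lintegral_meas_lt_mul μ (.of_forall fun ω => by positivity)
        (hf.abs.div_const 3).aemeasurable (by norm_num),
      lintegral_rpow_eq_lintegral_meas_lt_mul μ (.of_forall fun ω => by positivity)
        (measurable_const (a := 18 * σ)).aemeasurable (by norm_num),
      lintegral_rpow_eq_lintegral_meas_lt_mul μ (.of_forall fun ω => abs_nonneg (f ω))
        hf.abs.aemeasurable (by norm_num), mul_left_comm, ← mul_add]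
    gcongr
    rw [← lintegral_const_mul' _ _ (by simp), ← lintegral_add_left']
    · refine setLIntegral_mono' measurableSet_Ioi fun t ht => ?_
      rw [← mul_assoc, ← add_mul]
      gcongr
      exact tail t ht
    · refine (Measurable.mul (Antitone.measurable fun s t hst => ?_) hmeas).aemeasurable
      exact measure_mono fun x (hx : t < _) => lt_of_le_of_lt hst hx
  have hpow : ∀ x : ℝ, x ^ (4 : ℝ) = x ^ 4 := fun x => by norm_cast
  simp only [hpow] at hcmp
  have e1 : ∀ ω, (|f ω| / 3) ^ 4 = f ω ^ 4 / 81 := fun ω => by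
    rw [div_pow, Even.pow_abs (by decide)]; norm_num
  have e2 : ∀ ω, |f ω| ^ 4 = f ω ^ 4 := fun ω => Even.pow_abs (by decide) _
  simp only [e1, e2] at hcmp
  have hM0 : 0 ≤ ∫ ω, f ω ^ 4 ∂μ := integral_nonneg fun ω => by positivity
  rw [← ofReal_integral_eq_lintegral_ofReal (hf4.div_const 81)
      (.of_forall fun ω => by positivity),
    ← ofReal_integral_eq_lintegral_ofReal hf4 (.of_forall fun ω => by positivity),
    lintegral_const, measure_univ, mul_one, ← ENNReal.ofReal_mul (by norm_num),
    ← ENNReal.ofReal_add (by positivity) (by positivity),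
    ENNReal.ofReal_le_ofReal_iff (by positivity), integral_div] at hcmp
  have : (18 * σ) ^ 4 = 18 ^ 4 * v ^ 2 := by rw [← hσ2]; ring
  linarith

open ProbabilityTheory in
theorem integral_sum_sq_eq_and_pow_four_le {Ω ι : Type*} [MeasurableSpace Ω] {μ : Measure Ω}
    [IsProbabilityMeasure μ] {Y : ι → Ω → ℝ} (hY : ∀ i, Measurable (Y i)) (hind : iIndepFun Y μ)
    (hb : ∀ i, MemLp (Y i) ∞ μ) (h0 : ∀ i, ∫ ω, Y i ω ∂μ = 0) {B : ℝ} (hB : 3 ≤ B)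
    (h4 : ∀ i, ∫ ω, Y i ω ^ 4 ∂μ ≤ B * (∫ ω, Y i ω ^ 2 ∂μ) ^ 2) (s : Finset ι) :
    ∫ ω, (∑ i ∈ s, Y i ω) ^ 2 ∂μ = ∑ i ∈ s, ∫ ω, Y i ω ^ 2 ∂μ ∧
      ∫ ω, (∑ i ∈ s, Y i ω) ^ 4 ∂μ ≤ B * (∑ i ∈ s, ∫ ω, Y i ω ^ 2 ∂μ) ^ 2 := by
  classical
  induction s using Finset.induction_on with
  | empty => simp
  | insert a s ha ih =>
    set S : Ω → ℝ := fun ω => ∑ i ∈ s, Y i ω with hS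
    set X := Y a with hX
    have hSm : Measurable S := Finset.measurable_sum _ fun i _ => hY i
    have hSb : MemLp S ∞ μ := memLp_finsetSum _ fun i _ => hb i
    have hSX : IndepFun S X μ := by
      have := hind.indepFun_finsetSum_of_notMem hY ha
      convert this using 1
      ext ω; simp [hS]
    have hpow : ∀ {g : Ω → ℝ}, MemLp g ∞ μ → ∀ k : ℕ, MemLp (fun ω => g ω ^ k) ∞ μ := by
      intro g hg k
      induction k with
      | zero => simpa using memLp_const 1
      | succ k ih =>
        simp_rw [pow_succ]
        exact hg.mul' ih
    have hint : ∀ k l : ℕ, Integrable (fun ω => S ω ^ k * X ω ^ l) μ := fun k l =>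
      MemLp.integrable le_top ((hpow (hb a) l).mul' (hpow hSb k))
    have hprod : ∀ k l : ℕ, ∫ ω, S ω ^ k * X ω ^ l ∂μ = (∫ ω, S ω ^ k ∂μ) * ∫ ω, X ω ^ l ∂μ :=
      fun k l => (hSX.comp (measurable_id.pow_const k)
        (measurable_id.pow_const l)).integral_fun_mul_eq_mul_integral
          (hSm.pow_const k).aestronglyMeasurable ((hY a).pow_const l).aestronglyMeasurable
    have hS0 : ∫ ω, S ω ∂μ = 0 := by
      rw [integral_finsetSum _ fun i _ => (hb i).integrable le_top]
      exact Finset.sum_eq_zero fun i _ => h0 i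
    have p11 := hprod 1 1
    have p31 := hprod 3 1
    have p13 := hprod 1 3
    have p22 := hprod 2 2
    have hX0 : ∫ ω, X ω ∂μ = 0 := h0 a
    simp only [pow_one, hS0, hX0, mul_zero, zero_mul] at p11 p31 p13
    have i20 := hint 2 0
    have i02 := hint 0 2
    have i40 := hint 4 0
    have i04 := hint 0 4
    have i11 := hint 1 1
    have i31 := hint 3 1
    have i13 := hint 1 3
    have i22 := hint 2 2
    simp only [pow_zero, mul_one, one_mul, pow_one] at i20 i02 i40 i04 i11 i31 i13
    have e2 : ∫ ω, (X ω + S ω) ^ 2 ∂μ = ∫ ω, X ω ^ 2 ∂μ + ∫ ω, S ω ^ 2 ∂μ := by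
      have : ∀ ω, (X ω + S ω) ^ 2 = X ω ^ 2 + S ω ^ 2 + 2 * (S ω * X ω) := fun ω => by ring
      simp_rw [this]
      rw [integral_add (i02.fun_add i20) (i11.const_mul 2), integral_add i02 i20,
        integral_const_mul, p11]
      ring
    have e4 : ∫ ω, (X ω + S ω) ^ 4 ∂μ = ∫ ω, X ω ^ 4 ∂μ + ∫ ω, S ω ^ 4 ∂μ
        + 6 * ((∫ ω, S ω ^ 2 ∂μ) * ∫ ω, X ω ^ 2 ∂μ) := by
      have : ∀ ω, (X ω + S ω) ^ 4 = X ω ^ 4 + S ω ^ 4 + 6 * (S ω ^ 2 * X ω ^ 2)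
          + 4 * (S ω ^ 3 * X ω) + 4 * (S ω * X ω ^ 3) := fun ω => by ring
      simp_rw [this]
      rw [integral_add (((i04.fun_add i40).fun_add (i22.const_mul 6)).fun_add (i31.const_mul 4))
          (i13.const_mul 4),
        integral_add ((i04.fun_add i40).fun_add (i22.const_mul 6)) (i31.const_mul 4),
        integral_add (i04.fun_add i40) (i22.const_mul 6), integral_add i04 i40,
        integral_const_mul, integral_const_mul, integral_const_mul, p31, p13, p22]
      ring
    simp only [Finset.sum_insert ha]
    refine ⟨e2.trans (by rw [ih.1]), ?_⟩
    refine e4.le.trans ?_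
    have hx := h4 a
    have hs := ih.2
    rw [ih.1]
    have hv : 0 ≤ ∫ ω, X ω ^ 2 ∂μ := integral_nonneg fun ω => sq_nonneg _
    have hw : 0 ≤ ∑ i ∈ s, ∫ ω, Y i ω ^ 2 ∂μ :=
      Finset.sum_nonneg fun i _ => integral_nonneg fun ω => sq_nonneg _
    nlinarith [mul_nonneg hw hv]

theorem sqrt_integral_sq_le_integral_abs {Ω : Type*} [MeasurableSpace Ω] {μ : Measure Ω}
    {Z : Ω → ℝ} (h1 : Integrable Z μ) (h2 : Integrable (fun ω => Z ω ^ 2) μ)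
    (h4 : Integrable (fun ω => Z ω ^ 4) μ) {B : ℝ} (hB : 0 < B)
    (h : ∫ ω, Z ω ^ 4 ∂μ ≤ B * (∫ ω, Z ω ^ 2 ∂μ) ^ 2) :
    √(∫ ω, Z ω ^ 2 ∂μ) ≤ 2 * √(2 * B) * ∫ ω, |Z ω| ∂μ := by
  set m := ∫ ω, Z ω ^ 2 ∂μ with hm
  have hm0 : 0 ≤ m := integral_nonneg fun ω => sq_nonneg _
  have hI : 0 ≤ ∫ ω, |Z ω| ∂μ := integral_nonneg fun ω => abs_nonneg _
  rcases hm0.eq_or_lt with hm1 | hm1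
  · rw [← hm1, Real.sqrt_zero]
    positivity
  set c := √(2 * B) with hc
  set σ := √m with hσ
  have hc0 : 0 < c := Real.sqrt_pos.2 (by positivity)
  have hσ0 : 0 < σ := Real.sqrt_pos.2 hm1
  have hc2 : c ^ 2 = 2 * B := Real.sq_sqrt (by positivity)
  have hσ2 : σ ^ 2 = m := Real.sq_sqrt hm0
  have hpt : ∀ ω, (c * σ) ^ 2 * Z ω ^ 2 ≤ (c * σ) ^ 3 * |Z ω| + Z ω ^ 4 := by
    intro ω
    have hl : 0 < c * σ := by positivity
    rw [← sq_abs (Z ω), ← Even.pow_abs (by decide : Even 4) (Z ω)]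
    set u := |Z ω|
    have hu : 0 ≤ u := abs_nonneg _
    set l := c * σ
    rcases le_total u l with hul | hul
    · have : l ^ 2 * u ^ 2 ≤ l ^ 3 * u := by
        have := mul_le_mul_of_nonneg_left hul (show 0 ≤ l ^ 2 * u by positivity)
        nlinarith
      have : 0 ≤ u ^ 4 := by positivity
      linarith
    · have : l ^ 2 * u ^ 2 ≤ u ^ 4 := by
        have : l ^ 2 ≤ u ^ 2 := by gcongr
        nlinarith [sq_nonneg u]
      have : 0 ≤ l ^ 3 * u := by positivity
      linarith
  have hint := integral_mono (h2.const_mul ((c * σ) ^ 2))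
    ((h1.abs.const_mul ((c * σ) ^ 3)).add h4) hpt
  simp only [Pi.add_apply] at hint
  rw [integral_const_mul, integral_add (h1.abs.const_mul _) h4, integral_const_mul, ← hm] at hint
  have h5 : (c * σ) ^ 2 * m ≤ (c * σ) ^ 3 * (∫ ω, |Z ω| ∂μ) + B * m ^ 2 := by linarith
  have h6 : σ * (B * σ ^ 3) ≤ (2 * c * ∫ ω, |Z ω| ∂μ) * (B * σ ^ 3) := by
    have e : (c * σ) ^ 3 = 2 * B * c * σ ^ 3 := by rw [← hc2]; ring
    rw [e, mul_pow, hc2, ← hσ2] at h5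
    nlinarith
  exact le_of_mul_le_mul_right h6 (by positivity)

theorem isotropic_integral_inner_sq {n : ℕ} {C : Set (EuclideanSpace ℝ (Fin n))} {L : ℝ}
    (h : IsIsotropic C L) (y : EuclideanSpace ℝ (Fin n)) :
    ∫ x in C, ⟪x, y⟫ ^ 2 = L ^ 2 * ‖y‖ ^ 2 := by
  rcases eq_or_ne y 0 with rfl | hy
  · simp
  have hn : ‖y‖ ≠ 0 := norm_ne_zero_iff.2 hy
  have h1 := h.2.2.2 (‖y‖⁻¹ • y) (by rw [norm_smul, norm_inv, norm_norm, inv_mul_cancel₀ hn])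
  simp_rw [inner_smul_right, mul_pow] at h1
  rw [integral_const_mul] at h1
  rw [← h1, inv_pow]
  field_simp

theorem setIntegral_inner_pow_four_le {n : ℕ} {C : Set (EuclideanSpace ℝ (Fin n))}
    (hconv : Convex ℝ C) (hcomp : IsCompact C) (hvol : volume C = 1)
    (y : EuclideanSpace ℝ (Fin n)) :
    ∫ x in C, ⟪x, y⟫ ^ 4 ≤ 162 * 18 ^ 4 * (∫ x in C, ⟪x, y⟫ ^ 2) ^ 2 := by
  have : IsProbabilityMeasure (volume.restrict C) := ⟨by simpa using hvol⟩
  have hcont : Continuous fun x : EuclideanSpace ℝ (Fin n) => ⟪x, y⟫ := by fun_prop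
  have hle : ∀ a : ℝ, MeasurableSet {x : EuclideanSpace ℝ (Fin n) | |⟪x, y⟫| ≤ a} := fun a =>
    measurableSet_le hcont.abs.measurable measurable_const
  have hlt : ∀ a : ℝ, MeasurableSet {x : EuclideanSpace ℝ (Fin n) | a < |⟪x, y⟫|} := fun a =>
    measurableSet_lt measurable_const hcont.abs.measurable
  refine integral_pow_four_le_of_tail hcont.measurable
    ((hcont.pow 2).continuousOn.integrableOn_compact hcomp)
    ((hcont.pow 4).continuousOn.integrableOn_compact hcomp) fun a ha => ?_
  rw [Measure.restrict_apply (hlt _), Measure.restrict_apply (hle _),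
    Measure.restrict_apply (hlt _)]
  refine volume_mul_le_sq ((hlt _).inter hcomp.measurableSet) ((hle _).inter hcomp.measurableSet)
    ((hlt _).inter hcomp.measurableSet) ?_
  rintro u ⟨hu, huC⟩ v ⟨hv, hvC⟩
  refine ⟨?_, ?_⟩
  · simp only [Set.mem_ofPred_eq] at hu hv ⊢
    rw [inner_smul_left, inner_add_left, abs_mul]
    have h1 : |⟪u, y⟫| ≤ |⟪u, y⟫ + ⟪v, y⟫| + |⟪v, y⟫| := by
      simpa using abs_sub (⟪u, y⟫ + ⟪v, y⟫) ⟪v, y⟫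
    simp only [conj_trivial]
    rw [abs_of_pos (by norm_num : (0 : ℝ) < 1 / 2)]
    linarith
  · rw [smul_add]
    exact hconv huC hvC (by norm_num) (by norm_num) (by norm_num)

theorem isotropic_sum_inner_sq_and_pow_four {n s : ℕ} {C : Set (EuclideanSpace ℝ (Fin n))} {L : ℝ}
    (hconv : Convex ℝ C) (hcomp : IsCompact C) (h : IsIsotropic C L)
    (t : Fin s → ℝ) (y : EuclideanSpace ℝ (Fin n)) :
    ∫ x in Set.univ.pi fun _ : Fin s => C, ⟪∑ j, t j • x j, y⟫ ^ 2
        = (L * ‖y‖ * euclNorm t) ^ 2 ∧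
      ∫ x in Set.univ.pi fun _ : Fin s => C, ⟪∑ j, t j • x j, y⟫ ^ 4
        ≤ 162 * 18 ^ 4 * (∫ x in Set.univ.pi fun _ : Fin s => C, ⟪∑ j, t j • x j, y⟫ ^ 2) ^ 2 := by
  have : IsProbabilityMeasure (volume.restrict C) := ⟨by simpa using h.1⟩
  have hcont : Continuous fun x : EuclideanSpace ℝ (Fin n) => ⟪x, y⟫ := by fun_prop
  rw [volume_pi, Measure.restrict_pi_pi]
  set X : Fin s → EuclideanSpace ℝ (Fin n) → ℝ := fun j x => t j * ⟪x, y⟫ with hX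
  have hXc : ∀ j, Continuous (X j) := fun j => continuous_const.mul hcont
  have hXb : ∀ j, MemLp (X j) ∞ (volume.restrict C) := fun j => by
    obtain ⟨R, hR⟩ := hcomp.exists_bound_of_continuousOn (hXc j).continuousOn
    exact memLp_top_of_bound (hXc j).aestronglyMeasurable R
      ((ae_restrict_mem hcomp.measurableSet).mono hR)
  have heval : ∀ j (k : ℕ), ∫ x, X j (x j) ^ k ∂(Measure.pi fun _ : Fin s => volume.restrict C)
      = t j ^ k * ∫ x in C, ⟪x, y⟫ ^ k := fun j k => by
    rw [integral_comp_eval (μ := fun _ : Fin s => volume.restrict C) (i := j)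
      (f := fun x => X j x ^ k) ((hXc j).pow k).aestronglyMeasurable]
    simp only [hX, mul_pow]
    rw [integral_const_mul]
  have hmean : ∫ x in C, ⟪x, y⟫ = 0 := by
    have hi : Integrable (fun x : EuclideanSpace ℝ (Fin n) => x) (volume.restrict C) :=
      continuous_id.continuousOn.integrableOn_compact hcomp
    have := integral_inner (𝕜 := ℝ) hi y
    simp_rw [fun x => real_inner_comm x y] at this
    rw [this, h.2.1, inner_zero_left]
  have key := integral_sum_sq_eq_and_pow_four_le
    (μ := Measure.pi fun _ : Fin s => volume.restrict C) (Y := fun j x => X j (x j))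
    (fun j => (hXc j).measurable.comp (measurable_pi_apply j))
    (ProbabilityTheory.iIndepFun_pi fun j => (hXc j).measurable.aemeasurable)
    (fun j => (hXb j).comp_measurePreserving (measurePreserving_eval _ j))
    (fun j => by
      have := heval j 1
      simpa [hmean] using this)
    (B := 162 * 18 ^ 4) (by norm_num)
    (fun j => by
      rw [heval, heval, mul_pow, ← pow_mul, mul_left_comm]
      exact mul_le_mul_of_nonneg_left (setIntegral_inner_pow_four_le hconv hcomp h.1 y)
        (by positivity))
    Finset.univ
  have hsum : ∀ x : Fin s → EuclideanSpace ℝ (Fin n),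
      ⟪∑ j, t j • x j, y⟫ = ∑ j, X j (x j) := fun x => by
    simp [hX, sum_inner, inner_smul_left]
  simp_rw [hsum]
  refine ⟨?_, by rw [key.1]; exact key.2⟩
  rw [key.1]
  simp_rw [heval, isotropic_integral_inner_sq h]
  rw [← Finset.sum_mul, mul_pow, mul_pow, euclNorm,
    Real.sq_sqrt (Finset.sum_nonneg fun _ _ => sq_nonneg _)]
  ring

theorem exists_inner_le_gauge {E : Type*} [NormedAddCommGroup E] [InnerProductSpace ℝ E]
    [FiniteDimensional ℝ E] {K : Set E} (hconv : Convex ℝ K) (hK : Absorbent ℝ K) (x : E) :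
    ∃ y : E, ⟪x, y⟫ = gauge K x ∧ ∀ z, ⟪z, y⟫ ≤ gauge K z := by
  rcases eq_or_ne x 0 with rfl | hx
  · exact ⟨0, by simp, fun z => by simpa using gauge_nonneg z⟩
  obtain ⟨g, hg, hgK⟩ := exists_extension_of_le_sublinear
    (LinearPMap.mkSpanSingleton x (gauge K x) hx) (gauge K)
    (fun c hc z => gauge_smul_of_nonneg hc.le z) (gauge_add_le hconv hK) (by
      rintro ⟨z, hz⟩
      obtain ⟨c, rfl⟩ := Submodule.mem_span_singleton.1 hz
      rw [LinearPMap.mkSpanSingleton'_apply]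
      rcases le_total 0 c with hc | hc
      · rw [gauge_smul_of_nonneg hc]; rfl
      · exact le_trans (mul_nonpos_of_nonpos_of_nonneg hc (gauge_nonneg x)) (gauge_nonneg _))
  refine ⟨(InnerProductSpace.toDual ℝ E).symm (LinearMap.toContinuousLinearMap g), ?_, ?_⟩
  · rw [real_inner_comm, InnerProductSpace.toDual_symm_apply]
    have := hg ⟨x, Submodule.mem_span_singleton_self x⟩
    exact this.trans (LinearPMap.mkSpanSingleton'_apply_self x (gauge K x) _ _)
  · intro z
    rw [real_inner_comm, InnerProductSpace.toDual_symm_apply]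
    exact hgK z

theorem IsSymmConvexBody.mem_nhds_zero {n : ℕ} {K : Set (EuclideanSpace ℝ (Fin n))}
    (hK : IsSymmConvexBody K) : K ∈ nhds 0 := by
  obtain ⟨hconv, -, ⟨x, hx⟩, hsymm⟩ := hK
  have hx' : -x ∈ interior K := by
    have h : -x ∈ Homeomorph.neg (EuclideanSpace ℝ (Fin n)) '' interior K := ⟨x, hx, rfl⟩
    rw [Homeomorph.image_interior] at h
    rw [hsymm]
    simpa using h
  have := hconv.interior hx hx' (by norm_num : (0 : ℝ) ≤ 1 / 2) (by norm_num : (0 : ℝ) ≤ 1 / 2)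
    (by norm_num)
  rw [smul_neg, add_neg_cancel] at this
  exact mem_interior_iff_mem_nhds.1 this

/-- there is an absolute constant `c₁ > 0` such that for every isotropic
convex body `C` in `ℝⁿ`, every centrally symmetric convex body `K` and every `t ∈ ℝˢ`,
`c₁ L_C R(K°) ‖t‖₂ ≤ ∫_C⋯∫_C ‖∑ t_j x_j‖_K ≤ √n L_C R(K°) ‖t‖₂`,
where `R(K°)`, the radius of the polar body, is the least `b ≥ 0` with
`‖x‖_K ≤ b ‖x‖₂` for all `x`. -/
theorem stmt5 :
    ∃ c₁ : ℝ, 0 < c₁ ∧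
      ∀ (n s : ℕ) (_hs : 1 ≤ s)
        (C : Set (EuclideanSpace ℝ (Fin n))) (_hC : IsConvexBody C)
        (L : ℝ) (_hCiso : IsIsotropic C L)
        (K : Set (EuclideanSpace ℝ (Fin n))) (_hK : IsSymmConvexBody K)
        (b : ℝ)
        (_hb : IsLeast {b' : ℝ | 0 ≤ b' ∧ ∀ x, gauge K x ≤ b' * ‖x‖} b)
        (t : Fin s → ℝ),
        c₁ * L * b * euclNorm t
            ≤ (∫ x in Set.univ.pi fun _ : Fin s => C, gauge K (∑ j, t j • x j)) ∧
          (∫ x in Set.univ.pi fun _ : Fin s => C, gauge K (∑ j, t j • x j))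
            ≤ Real.sqrt n * L * b * euclNorm t := by
  set A : ℝ := 2 * √(2 * (162 * 18 ^ 4)) with hA
  have hA0 : 0 < A := by positivity
  refine ⟨A⁻¹, inv_pos.2 hA0, ?_⟩
  intro n s _ C hC L hiso K hK b hb t
  have hL : 0 < L := hiso.2.2.1
  have ht0 : 0 ≤ euclNorm t := Real.sqrt_nonneg _
  have hK0 : K ∈ nhds 0 := hK.mem_nhds_zero
  have habs : Absorbent ℝ K := absorbent_nhds_zero hK0
  have hgc : Continuous (gauge K) := continuous_gauge hK.1 hK0
  have hgneg : ∀ x, gauge K (-x) = gauge K x := gauge_neg fun x hx => by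
    rw [hK.2.2.2]
    simpa using hx
  set P : Set (Fin s → EuclideanSpace ℝ (Fin n)) := Set.univ.pi fun _ => C with hP
  have hPc : IsCompact P := isCompact_univ_pi fun _ => hC.2.1
  have hint : ∀ {f : (Fin s → EuclideanSpace ℝ (Fin n)) → ℝ}, Continuous f →
      Integrable f (volume.restrict P) := fun hf => hf.continuousOn.integrableOn_compact hPc
  have hprob : IsProbabilityMeasure (volume.restrict P) := by
    have : IsProbabilityMeasure (volume.restrict C) := ⟨by simpa using hiso.1⟩
    rw [hP, volume_pi, Measure.restrict_pi_pi]
    infer_instance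
  have hSc : Continuous fun x : Fin s → EuclideanSpace ℝ (Fin n) => ∑ j, t j • x j := by fun_prop
  have hmom := isotropic_sum_inner_sq_and_pow_four (s := s) hC.1 hC.2.1 hiso t
  constructor
  · set I := ∫ x in P, gauge K (∑ j, t j • x j) with hI
    have hI0 : 0 ≤ I := integral_nonneg fun x => gauge_nonneg _
    rcases ht0.eq_or_lt with ht1 | ht1
    · rw [← ht1, mul_zero]
      exact hI0
    have hx : ∀ x, gauge K x ≤ A * I / (L * euclNorm t) * ‖x‖ := by
      intro x
      obtain ⟨y, hy, hyK⟩ := exists_inner_le_gauge hK.1 habs x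
      have hyK' : ∀ z, |⟪z, y⟫| ≤ gauge K z := fun z => by
        refine abs_le.2 ⟨?_, hyK z⟩
        have := hyK (-z)
        rw [inner_neg_left, hgneg] at this
        linarith
      have hZc : Continuous fun x : Fin s → EuclideanSpace ℝ (Fin n) => ⟪∑ j, t j • x j, y⟫ :=
        hSc.inner continuous_const
      have h1 := sqrt_integral_sq_le_integral_abs (hint hZc) (hint (hZc.pow 2)) (hint (hZc.pow 4))
        (by norm_num) (hmom y).2
      rw [(hmom y).1, Real.sqrt_sq (by positivity)] at h1
      have h2 : ∫ x in P, |⟪∑ j, t j • x j, y⟫| ≤ I :=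
        integral_mono (hint hZc.abs) (hint (hgc.comp hSc)) fun x => hyK' _
      have h3 : ‖y‖ ≤ A * I / (L * euclNorm t) := by
        rw [le_div_iff₀ (by positivity)]
        calc ‖y‖ * (L * euclNorm t) = L * ‖y‖ * euclNorm t := by ring
          _ ≤ _ := h1
          _ ≤ A * I := by gcongr
      calc gauge K x = ⟪x, y⟫ := hy.symm
        _ ≤ ‖x‖ * ‖y‖ := real_inner_le_norm x y
        _ ≤ ‖x‖ * (A * I / (L * euclNorm t)) := by gcongr
        _ = _ := mul_comm _ _
    have hbI := hb.2 ⟨by positivity, hx⟩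
    rw [le_div_iff₀ (by positivity)] at hbI
    rw [show A⁻¹ * L * b * euclNorm t = A⁻¹ * (b * (L * euclNorm t)) by ring,
      inv_mul_le_iff₀ hA0]
    exact hbI
  · have hnc : Continuous fun x : Fin s → EuclideanSpace ℝ (Fin n) => ‖∑ j, t j • x j‖ := hSc.norm
    have h1 : ∫ x in P, gauge K (∑ j, t j • x j) ≤ b * ∫ x in P, ‖∑ j, t j • x j‖ := by
      rw [← integral_const_mul]
      exact integral_mono (hint (hgc.comp hSc)) (hint (continuous_const.mul hnc))
        fun x => hb.1.2 _
    have h2 : ∫ x in P, ‖∑ j, t j • x j‖ ^ 2 = n * (L * euclNorm t) ^ 2 := by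
      have : ∀ x : Fin s → EuclideanSpace ℝ (Fin n), ‖∑ j, t j • x j‖ ^ 2 =
          ∑ i, ⟪∑ j, t j • x j, EuclideanSpace.basisFun (Fin n) ℝ i⟫ ^ 2 := fun x => by
        rw [← (EuclideanSpace.basisFun (Fin n) ℝ).sum_sq_norm_inner_left]
        simp
      simp_rw [this]
      rw [integral_finsetSum _ fun i _ => hint (by fun_prop)]
      rw [Finset.sum_congr rfl fun i _ => (hmom (EuclideanSpace.basisFun (Fin n) ℝ i)).1]
      simp
    have h3 : (∫ x in P, ‖∑ j, t j • x j‖) ^ 2 ≤ ∫ x in P, ‖∑ j, t j • x j‖ ^ 2 :=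
      (even_two.convexOn_pow).map_integral_le (continuous_pow 2).continuousOn isClosed_univ
        (by simp) (hint hnc) (hint (hnc.pow 2))
    have h4 : ∫ x in P, ‖∑ j, t j • x j‖ ≤ √n * (L * euclNorm t) := by
      refine le_of_sq_le_sq ?_ (by positivity)
      rw [mul_pow, Real.sq_sqrt (Nat.cast_nonneg n), ← h2]
      exact h3
    calc _ ≤ _ := h1
      _ ≤ b * (√n * (L * euclNorm t)) := mul_le_mul_of_nonneg_left h4 hb.1.1
      _ = _ := by ring
end
end

section
/- Let K be a centrally symmetric convex body in ℝⁿ which is 2-convex with constant α. There is an absolute constant c > 0 such that for every s ≥ 1 and every t ∈ ℝˢ, the average (1/vol_n(K)^s) ∫_K⋯∫_K ‖∑_{j=1}^s t_j x_j‖_K dx₁⋯dx_s ≤ (c/α) ‖t‖₂. -/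
open MeasureTheory Real
open scoped ENNReal RealInnerProductSpace

noncomputable section

/-- `K` is 2-convex with constant `α`: its modulus of convexity satisfies
`δ_K(ε) ≥ αε²` for `ε ∈ (0,2]`, spelled out pointwise. -/
def IsTwoConvex {n : ℕ} (K : Set (EuclideanSpace ℝ (Fin n))) (α : ℝ) : Prop :=
  ∀ ε : ℝ, 0 < ε → ε ≤ 2 →
    ∀ x y : EuclideanSpace ℝ (Fin n), gauge K x ≤ 1 → gauge K y ≤ 1 →
      ε ≤ gauge K (x - y) → α * ε ^ 2 ≤ 1 - gauge K ((1 / 2 : ℝ) • (x + y))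

/-- A multiplicative Brunn–Minkowski property of the volume of `E`, in functional
(Prékopa–Leindler) form, with constant `c`. -/
def PrekopaLeindler (E : Type*) [Add E] [MeasureSpace E] (c : ℝ≥0∞) : Prop :=
  ∀ f g h : E → ℝ≥0∞, Measurable f → Measurable g → Measurable h →
    (∀ x y, f x * g y ≤ h (x + y) ^ 2) →
    c * ((∫⁻ x, f x) * ∫⁻ x, g x) ≤ (∫⁻ x, h x) ^ 2

lemma volume_add_le_of_isCompact {A B C : Set ℝ} (hA : IsCompact A) (hB : IsCompact B)
    (hA0 : A.Nonempty) (hB0 : B.Nonempty) (hC : ∀ x ∈ A, ∀ y ∈ B, x + y ∈ C) :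
    volume A + volume B ≤ volume C := by
  obtain ⟨a, haA, ha⟩ := hA.exists_isGreatest hA0
  obtain ⟨b, hbB, hb⟩ := hB.exists_isLeast hB0
  have h1 : volume ((fun x => x + b) '' A) = volume A := by
    simp [Set.image_add_right, measure_preimage_add_right]
  have h2 : volume ((fun y => a + y) '' B) = volume B := by
    simp [Set.image_add_left, measure_preimage_add]
  have hdisj : AEDisjoint volume ((fun x => x + b) '' A) ((fun y => a + y) '' B) := by
    refine measure_mono_null (t := {a + b}) ?_ (by simp)
    rintro z ⟨⟨x, hx, rfl⟩, ⟨y, hy, hxy⟩⟩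
    have := ha hx
    have := hb hy
    simp only [Set.mem_singleton_iff] at *
    linarith
  have hm : MeasurableSet ((fun y => a + y) '' B) :=
    (hB.image (by fun_prop)).measurableSet
  rw [← h1, ← h2, ← measure_union₀ hm.nullMeasurableSet hdisj]
  refine measure_mono ?_
  rintro z (⟨x, hx, rfl⟩ | ⟨y, hy, rfl⟩)
  · exact hC _ hx _ hbB
  · exact hC _ haA _ hy

/-- The one-dimensional Brunn–Minkowski inequality. -/
lemma volume_add_le_of_measurableSet {A B C : Set ℝ} (hA : MeasurableSet A)
    (hB : MeasurableSet B) (hA0 : A.Nonempty) (hB0 : B.Nonempty)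
    (hC : ∀ x ∈ A, ∀ y ∈ B, x + y ∈ C) :
    volume A + volume B ≤ volume C := by
  obtain ⟨a, ha⟩ := hA0
  obtain ⟨b, hb⟩ := hB0
  rw [hA.measure_eq_iSup_isCompact, hB.measure_eq_iSup_isCompact]
  simp_rw [iSup_and']
  refine ENNReal.biSup_add_biSup_le' ⟨∅, by simp⟩ ⟨∅, by simp⟩ ?_
  rintro K ⟨hKA, hK⟩ L ⟨hLB, hL⟩
  refine (add_le_add (measure_mono (Set.subset_insert a K))
    (measure_mono (Set.subset_insert b L))).trans ?_
  exact volume_add_le_of_isCompact (hK.insert a) (hL.insert b) (Set.insert_nonempty _ _)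
    (Set.insert_nonempty _ _) fun x hx y hy =>
      hC x (Set.insert_subset ha hKA hx) y (Set.insert_subset hb hLB hy)

lemma lintegral_add_le_of_le_one {f g h : ℝ → ℝ} (hf : Measurable f) (hg : Measurable g)
    (hh : Measurable h) (hf0 : 0 ≤ f) (hg0 : 0 ≤ g) (hh0 : 0 ≤ h)
    (hf1 : ∀ x, f x ≤ 1) (hg1 : ∀ x, g x ≤ 1)
    (hfs : ∀ r < 1, ∃ x, r < f x) (hgs : ∀ r < 1, ∃ x, r < g x)
    (H : ∀ x y, f x * g y ≤ h (x + y) ^ 2) :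
    (∫⁻ x, ENNReal.ofReal (f x)) + ∫⁻ x, ENNReal.ofReal (g x)
      ≤ ∫⁻ x, ENNReal.ofReal (h x) := by
  rw [lintegral_eq_lintegral_meas_lt _ (.of_forall hf0) hf.aemeasurable,
    lintegral_eq_lintegral_meas_lt _ (.of_forall hg0) hg.aemeasurable,
    lintegral_eq_lintegral_meas_lt _ (.of_forall hh0) hh.aemeasurable, ← lintegral_add_left]
  · refine setLIntegral_mono_ae' measurableSet_Ioi (.of_forall fun t (ht : 0 < t) => ?_)
    rcases lt_or_ge t 1 with h1 | h1
    · refine volume_add_le_of_measurableSet (measurableSet_lt measurable_const hf)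
        (measurableSet_lt measurable_const hg) (hfs t h1) (hgs t h1) ?_
      intro x (hx : t < f x) y (hy : t < g y)
      refine lt_of_pow_lt_pow_left₀ 2 (hh0 _) (lt_of_lt_of_le ?_ (H x y))
      nlinarith
    · have e1 : {a | t < f a} = ∅ := by
        ext x; simpa using (hf1 x).trans h1
      have e2 : {a | t < g a} = ∅ := by
        ext x; simpa using (hg1 x).trans h1
      simp [e1, e2]
  · exact (Antitone.measurable fun s t hst => measure_mono fun x (hx : t < f x) => hst.trans_lt hx)

lemma exists_lt_toReal_of_iSup_eq_one {f : ℝ → ℝ≥0∞} (hf : ⨆ x, f x = 1) {r : ℝ} (hr : r < 1) :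
    ∃ x, r < (f x).toReal := by
  have h1 : ENNReal.ofReal r < ⨆ x, f x := by
    rw [hf]
    exact ENNReal.ofReal_lt_one.2 hr
  obtain ⟨x, hx⟩ := lt_iSup_iff.1 h1
  refine ⟨x, not_le.1 fun h => hx.not_ge ?_⟩
  rw [← ENNReal.ofReal_toReal ((le_iSup f x).trans_lt (hf ▸ ENNReal.one_lt_top)).ne]
  exact ENNReal.ofReal_le_ofReal h

lemma lintegral_mul_le_of_iSup_eq_one {f g h : ℝ → ℝ≥0∞} (hf : Measurable f)
    (hg : Measurable g) (hh : Measurable h) (hf1 : ⨆ x, f x = 1) (hg1 : ⨆ x, g x = 1)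
    (H : ∀ x y, f x * g y ≤ h (x + y) ^ 2) :
    4 * ((∫⁻ x, f x) * ∫⁻ x, g x) ≤ (∫⁻ x, h x) ^ 2 := by
  have hfl : ∀ x, f x ≤ 1 := fun x => hf1 ▸ le_iSup f x
  have hgl : ∀ x, g x ≤ 1 := fun x => hg1 ▸ le_iSup g x
  have key := lintegral_add_le_of_le_one (f := fun x => (f x).toReal)
    (g := fun x => (g x).toReal) (h := fun x => (min (h x) 1).toReal)
    hf.ennreal_toReal hg.ennreal_toReal (hh.min measurable_const).ennreal_toReal
    (fun _ => ENNReal.toReal_nonneg) (fun _ => ENNReal.toReal_nonneg)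
    (fun _ => ENNReal.toReal_nonneg)
    (fun x => ENNReal.toReal_mono (by simp) (hfl x))
    (fun x => ENNReal.toReal_mono (by simp) (hgl x)) ?_ ?_ ?_
  · have e : ∀ u : ℝ → ℝ≥0∞, (∀ x, u x ≤ 1) → ∫⁻ x, ENNReal.ofReal (u x).toReal = ∫⁻ x, u x :=
      fun u hu => lintegral_congr fun x =>
        ENNReal.ofReal_toReal ((hu x).trans_lt ENNReal.one_lt_top).ne
    rw [e f hfl, e g hgl, e (fun x => min (h x) 1) (fun x => min_le_right _ _)] at key
    have key2 := key.trans (lintegral_mono fun x => min_le_left (h x) 1)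
    refine le_trans ?_ (pow_le_pow_left' key2 2)
    generalize (∫⁻ x, f x) = a
    generalize (∫⁻ x, g x) = b
    by_cases ha : a = ∞
    · simp [ha]
    by_cases hb : b = ∞
    · simp [hb]
    lift a to NNReal using ha
    lift b to NNReal using hb
    norm_cast
    rw [← NNReal.coe_le_coe]
    push_cast
    nlinarith [sq_nonneg ((a : ℝ) - b)]
  · exact fun r hr => exists_lt_toReal_of_iSup_eq_one hf1 hr
  · exact fun r hr => exists_lt_toReal_of_iSup_eq_one hg1 hr
  · intro x y
    rw [← ENNReal.toReal_mul, ← ENNReal.toReal_pow]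
    refine ENNReal.toReal_mono (ENNReal.pow_ne_top (by simp)) ?_
    rcases le_total (h (x + y)) 1 with h1 | h1
    · rw [min_eq_left h1]
      exact H x y
    · rw [min_eq_right h1, one_pow]
      exact mul_le_one' (hfl x) (hgl y)

lemma lintegral_mul_le_of_bounded {f g h : ℝ → ℝ≥0∞} (hf : Measurable f)
    (hg : Measurable g) (hh : Measurable h) (hft : ⨆ x, f x ≠ ∞) (hgt : ⨆ x, g x ≠ ∞)
    (H : ∀ x y, f x * g y ≤ h (x + y) ^ 2) :
    4 * ((∫⁻ x, f x) * ∫⁻ x, g x) ≤ (∫⁻ x, h x) ^ 2 := by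
  set M := ⨆ x, f x with hM
  set N := ⨆ x, g x with hN
  by_cases hM0 : M = 0
  · have : ∀ x, f x = 0 := by simpa [hM] using hM0
    simp [this]
  by_cases hN0 : N = 0
  · have : ∀ x, g x = 0 := by simpa [hN] using hN0
    simp [this]
  set R := (M⁻¹ * N⁻¹) ^ (1 / 2 : ℝ) with hR
  have hR2 : R ^ 2 = M⁻¹ * N⁻¹ := by
    rw [hR, ← ENNReal.rpow_natCast, ← ENNReal.rpow_mul]
    norm_num
  have key := lintegral_mul_le_of_iSup_eq_one (hf.const_mul M⁻¹) (hg.const_mul N⁻¹)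
    (hh.const_mul R) (by rw [← ENNReal.mul_iSup, ← hM, ENNReal.inv_mul_cancel hM0 hft])
    (by rw [← ENNReal.mul_iSup, ← hN, ENNReal.inv_mul_cancel hN0 hgt]) (fun x y => by
      rw [mul_pow, hR2, mul_mul_mul_comm]
      gcongr
      exact H x y)
  rw [lintegral_const_mul _ hf, lintegral_const_mul _ hg, lintegral_const_mul _ hh, mul_pow,
    hR2, mul_mul_mul_comm, mul_left_comm] at key
  refine (ENNReal.mul_le_mul_iff_right ?_ ?_).1 key
  · exact mul_ne_zero (ENNReal.inv_ne_zero.2 hft) (ENNReal.inv_ne_zero.2 hgt)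
  · exact ENNReal.mul_ne_top (ENNReal.inv_ne_top.2 hM0) (ENNReal.inv_ne_top.2 hN0)

lemma lintegral_eq_iSup_lintegral_min {f : ℝ → ℝ≥0∞} (hf : Measurable f) :
    ∫⁻ x, f x = ⨆ k : ℕ, ∫⁻ x, min (f x) k := by
  rw [← lintegral_iSup (fun k => hf.min measurable_const)]
  · refine lintegral_congr fun x => ?_
    rw [← inf_iSup_eq, ENNReal.iSup_natCast, inf_top_eq]
  · intro k l hkl x
    exact min_le_min_left _ (by exact_mod_cast hkl)

lemma prekopaLeindler_real : PrekopaLeindler ℝ 4 := by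
  intro f g h hf hg hh H
  rw [lintegral_eq_iSup_lintegral_min hf, lintegral_eq_iSup_lintegral_min hg]
  simp_rw [ENNReal.iSup_mul, ENNReal.mul_iSup]
  refine iSup_le fun k => iSup_le fun l => ?_
  refine lintegral_mul_le_of_bounded (hf.min measurable_const) (hg.min measurable_const) hh
    ?_ ?_ fun x y => (mul_le_mul' (min_le_left _ _) (min_le_left _ _)).trans (H x y)
  · exact ((iSup_le fun x => min_le_right _ _).trans_lt (ENNReal.natCast_lt_top k)).ne
  · exact ((iSup_le fun x => min_le_right _ _).trans_lt (ENNReal.natCast_lt_top l)).ne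

lemma PrekopaLeindler.prod {E F : Type*} [Add E] [Add F] [MeasureSpace E] [MeasureSpace F]
    [SFinite (volume : Measure E)] [SFinite (volume : Measure F)] {c d : ℝ≥0∞}
    (hE : PrekopaLeindler E c) (hF : PrekopaLeindler F d) : PrekopaLeindler (E × F) (c * d) := by
  intro f g h hf hg hh H
  rw [Measure.volume_eq_prod, lintegral_prod _ hf.aemeasurable, lintegral_prod _ hg.aemeasurable,
    lintegral_prod _ hh.aemeasurable]
  have key := hE (fun x => d * ∫⁻ y, f (x, y)) (fun x => ∫⁻ y, g (x, y))
    (fun x => ∫⁻ y, h (x, y)) (hf.lintegral_prod_right'.const_mul d) hg.lintegral_prod_right'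
    hh.lintegral_prod_right' fun x x' => by
      rw [mul_assoc]
      exact hF _ _ _ (hf.comp measurable_prodMk_left) (hg.comp measurable_prodMk_left)
        (hh.comp measurable_prodMk_left) fun y y' => H (x, y) (x', y')
  rw [lintegral_const_mul _ hf.lintegral_prod_right'] at key
  simpa only [mul_assoc] using key

lemma PrekopaLeindler.of_measurePreserving {E F : Type*} [Add E] [Add F] [MeasureSpace E]
    [MeasureSpace F] {c : ℝ≥0∞} (hE : PrekopaLeindler E c) (e : E → F)
    (he : MeasurePreserving e) (hadd : ∀ x y, e (x + y) = e x + e y) :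
    PrekopaLeindler F c := by
  intro f g h hf hg hh H
  rw [← he.lintegral_comp hf, ← he.lintegral_comp hg, ← he.lintegral_comp hh]
  refine hE _ _ _ (hf.comp he.measurable) (hg.comp he.measurable) (hh.comp he.measurable) ?_
  intro x y
  rw [hadd]
  exact H _ _

lemma prekopaLeindler_pi (n : ℕ) : PrekopaLeindler (Fin n → ℝ) (4 ^ n) := by
  induction n with
  | zero =>
    intro f g h _ _ _ H
    have e : ∀ x y : Fin 0 → ℝ, x = y := fun x y => Subsingleton.elim x y
    simp only [volume_pi, Measure.pi_of_empty _ 0, lintegral_dirac, pow_zero, one_mul]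
    simpa using H 0 0
  | succ n ih =>
    rw [pow_succ']
    refine (prekopaLeindler_real.prod ih).of_measurePreserving
      (MeasurableEquiv.piFinSuccAbove (fun _ => ℝ) 0).symm
      (volume_preserving_piFinSuccAbove (fun _ => ℝ) 0).symm ?_
    rintro ⟨a, x⟩ ⟨b, y⟩
    ext i
    refine Fin.cases ?_ (fun i => ?_) i <;> simp [MeasurableEquiv.piFinSuccAbove]

lemma prekopaLeindler_euclideanSpace (n : ℕ) :
    PrekopaLeindler (EuclideanSpace ℝ (Fin n)) (4 ^ n) :=
  (prekopaLeindler_pi n).of_measurePreserving _ (PiLp.volume_preserving_toLp (Fin n))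
    fun _ _ => rfl

open scoped Pointwise

namespace IsSymmConvexBody

variable {n : ℕ} {K : Set (EuclideanSpace ℝ (Fin n))}

lemma neg_mem (hK : IsSymmConvexBody K) {x : EuclideanSpace ℝ (Fin n)} (hx : x ∈ K) : -x ∈ K := by
  have := hK.2.2.2
  rw [this] at hx
  simpa using hx

lemma mem_nhds_zero_s8 (hK : IsSymmConvexBody K) : K ∈ nhds 0 := by
  obtain ⟨x, hx⟩ := hK.2.2.1
  have h := hK.1.combo_interior_self_mem_interior hx (hK.neg_mem (interior_subset hx))
    (a := 1 / 2) (b := 1 / 2) (by norm_num) (by norm_num) (by norm_num)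
  rw [smul_neg, add_neg_cancel] at h
  exact mem_interior_iff_mem_nhds.1 h

lemma mem_smul_of_gauge_le (hK : IsSymmConvexBody K) {x : EuclideanSpace ℝ (Fin n)} {r : ℝ}
    (hr : 0 ≤ r) (hx : gauge K x ≤ r) : x ∈ r • K := by
  have h0 : (0 : EuclideanSpace ℝ (Fin n)) ∈ K := mem_of_mem_nhds hK.mem_nhds_zero_s8
  rcases hr.eq_or_lt with rfl | hr
  · have : x = 0 := by
      by_contra hne
      exact hx.not_gt ((gauge_pos (absorbent_nhds_zero hK.mem_nhds_zero_s8)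
        ((NormedSpace.isVonNBounded_iff ℝ).2 hK.2.1.isBounded)).2 hne)
    exact ⟨0, h0, by simp [this]⟩
  · rw [Set.mem_smul_set_iff_inv_smul_mem₀ hr.ne', ← hK.2.1.isClosed.closure_eq,
      ← gauge_le_one_iff_mem_closure hK.1 hK.mem_nhds_zero_s8,
      gauge_smul_of_nonneg (inv_nonneg.2 hr.le), smul_eq_mul, inv_mul_le_iff₀ hr, mul_one]
    exact hx

lemma le_mul_gauge (hK : IsSymmConvexBody K) {u : EuclideanSpace ℝ (Fin n) →L[ℝ] ℝ} {b : ℝ}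
    (hu : ∀ x ∈ K, u x ≤ b) (z : EuclideanSpace ℝ (Fin n)) : u z ≤ b * gauge K z := by
  obtain ⟨k, hk, hz⟩ := hK.mem_smul_of_gauge_le (gauge_nonneg z) le_rfl
  have : u z = gauge K z * u k := by
    conv_lhs => rw [← hz]
    simp
  rw [this, mul_comm]
  exact mul_le_mul_of_nonneg_right (hu k hk) (gauge_nonneg z)

lemma volume_cap_le (hK : IsSymmConvexBody K) {α : ℝ} (hK2 : IsTwoConvex K α)
    {u : EuclideanSpace ℝ (Fin n) →L[ℝ] ℝ} {b : ℝ} (hb : 0 < b) (hu : ∀ x ∈ K, u x ≤ b)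
    {t : ℝ} (ht : 0 < t) :
    volume.real {x ∈ K | t ≤ u x} ≤ rexp (-(4 * α * n / b ^ 2) * t ^ 2) * volume.real K := by
  set A := {x ∈ K | t ≤ u x} with hA
  rcases A.eq_empty_or_nonempty with hA0 | ⟨a, ha⟩
  · rw [hA0, measureReal_empty]
    positivity
  have hKm : MeasurableSet K := hK.2.1.measurableSet
  have hKf : volume K ≠ ∞ := hK.2.1.measure_lt_top.ne
  have hAm : MeasurableSet A := hKm.inter (measurableSet_le measurable_const u.continuous.measurable)
  set r := 1 - α * (2 * t / b) ^ 2 with hr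
  have hmid : ∀ x ∈ A, ∀ y ∈ -A, gauge K ((1 / 2 : ℝ) • (x + y)) ≤ r := by
    intro x hx y hy
    have hyK : y ∈ K := by simpa using hK.neg_mem hy.1
    have hy2 : u y ≤ -t := by
      have := hy.2
      simp only [map_neg] at this
      linarith
    have := hK2 (2 * t / b) (by positivity)
      (by rw [div_le_iff₀ hb]; linarith [hx.2, hu x hx.1]) x y
      (gauge_le_one_of_mem hx.1) (gauge_le_one_of_mem hyK) (by
        rw [div_le_iff₀ hb]
        have h1 := hK.le_mul_gauge hu (x - y)
        rw [map_sub] at h1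
        linarith [hx.2])
    linarith
  have hr0 : 0 ≤ r := (gauge_nonneg _).trans (hmid a ha (-a) (by simpa using ha))
  have key := prekopaLeindler_euclideanSpace n (A.indicator 1) ((-A).indicator 1)
    (((2 * r) • K).indicator 1) (measurable_one.indicator hAm)
    (measurable_one.indicator hAm.neg)
    (measurable_one.indicator (hK.2.1.smul (2 * r)).measurableSet) (by
      intro x y
      by_cases hx : x ∈ A
      · by_cases hy : y ∈ -A
        · have hxy : x + y ∈ (2 * r) • K := by
            refine hK.mem_smul_of_gauge_le (by positivity) ?_
            have := hmid x hx y hy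
            rw [gauge_smul_of_nonneg (by norm_num), smul_eq_mul] at this
            linarith
          simp [hx, hxy, Set.indicator_of_mem hy]
        · simp [Set.indicator_of_notMem hy]
      · simp [hx])
  rw [lintegral_indicator_one hAm, lintegral_indicator_one hAm.neg,
    lintegral_indicator_one (hK.2.1.smul (2 * r)).measurableSet, Measure.measure_neg,
    Measure.addHaar_smul, finrank_euclideanSpace_fin] at key
  have key2 := ENNReal.toReal_mono (ENNReal.pow_ne_top (ENNReal.mul_ne_top ENNReal.ofReal_ne_top hKf)) key
  simp only [ENNReal.toReal_mul, ENNReal.toReal_pow, ENNReal.toReal_ofNat,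
    abs_of_nonneg (pow_nonneg (mul_nonneg zero_le_two hr0) n),
    ENNReal.toReal_ofReal (pow_nonneg (mul_nonneg zero_le_two hr0) n),
    ← measureReal_def] at key2
  have h4 : (volume.real A) ^ 2 ≤ (r ^ n * volume.real K) ^ 2 := by
    have e : (4 : ℝ) ^ n = (2 ^ n) ^ 2 := by rw [← pow_mul, mul_comm, pow_mul]; norm_num
    rw [e] at key2
    have h2 : (0 : ℝ) < (2 ^ n) ^ 2 := by positivity
    refine le_of_mul_le_mul_left ?_ h2
    calc _ = _ := by ring
      _ ≤ _ := key2
      _ = _ := by rw [mul_pow 2 r n]; ring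
  refine (le_of_sq_le_sq h4 (by positivity)).trans ?_
  gcongr
  calc r ^ n ≤ rexp (-(α * (2 * t / b) ^ 2)) ^ n :=
        pow_le_pow_left₀ hr0 (Real.one_sub_le_exp_neg _) n
    _ = _ := by
      rw [← Real.exp_nat_mul]
      congr 1
      field_simp
      ring

lemma integrableOn_of_continuous (hK : IsSymmConvexBody K) {f : EuclideanSpace ℝ (Fin n) → ℝ}
    (hf : Continuous f) : IntegrableOn f K :=
  hf.continuousOn.integrableOn_compact hK.2.1

lemma setIntegral_sq_le (hK : IsSymmConvexBody K) (hn : 0 < n) {α : ℝ} (hα : 0 < α)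
    (hK2 : IsTwoConvex K α) {u : EuclideanSpace ℝ (Fin n) →L[ℝ] ℝ} {b : ℝ} (hb : 0 < b)
    (hu : ∀ x ∈ K, u x ≤ b) :
    ∫ x in K, u x ^ 2 ≤ 1 / (2 * α * n) * b ^ 2 * volume.real K := by
  have hKm : MeasurableSet K := hK.2.1.measurableSet
  have hKf : volume K ≠ ∞ := hK.2.1.measure_lt_top.ne
  have hn' : (0 : ℝ) < n := by exact_mod_cast hn
  have hc : 0 < 4 * α * n / b ^ 2 := by positivity
  set c := 4 * α * n / b ^ 2 with hcdef
  rw [(hK.integrableOn_of_continuous (by fun_prop)).integral_eq_integral_meas_le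
    (.of_forall fun x => sq_nonneg _)]
  calc _ ≤ ∫ t in Set.Ioi 0, 2 * volume.real K * rexp (-c * t) := by
        refine integral_mono_of_nonneg (.of_forall fun _ => measureReal_nonneg)
          ((integrableOn_exp_mul_Ioi (by linarith) 0).const_mul _) ?_
        filter_upwards [ae_restrict_mem measurableSet_Ioi] with t (ht : 0 < t)
        have hs : 0 < √t := Real.sqrt_pos.2 ht
        have h1 := hK.volume_cap_le hK2 hb hu hs
        have h2 := hK.volume_cap_le hK2 (u := -u) hb
          (fun x hx => by simpa using hu _ (hK.neg_mem hx)) hs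
        rw [Real.sq_sqrt ht.le, ← hcdef] at h1 h2
        rw [measureReal_restrict_apply' hKm]
        calc _ ≤ volume.real ({x ∈ K | √t ≤ u x} ∪ {x ∈ K | √t ≤ (-u) x}) := by
              refine measureReal_mono ?_ ?_
              · rintro x ⟨hx : t ≤ u x ^ 2, hxK⟩
                rcases le_abs.1 (Real.sqrt_le_sqrt hx |>.trans (Real.sqrt_sq_eq_abs _).le) with h | h
                · exact Or.inl ⟨hxK, h⟩
                · exact Or.inr ⟨hxK, h⟩
              · exact ((measure_mono (by rintro x (h | h) <;> exact h.1)).trans_lt hKf.lt_top).ne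
          _ ≤ _ := measureReal_union_le _ _
          _ ≤ _ := by linarith
    _ = _ := by
        rw [integral_const_mul, integral_exp_mul_Ioi (by linarith)]
        simp only [mul_zero, Real.exp_zero, hcdef]
        field_simp
        ring

end IsSymmConvexBody

/-- A sum of independent copies of a centered square-integrable function has second moment
equal to the sum of the second moments. -/
lemma integral_sq_sum_mul_pi {E : Type*} [MeasurableSpace E] {ν : Measure E}
    [IsProbabilityMeasure ν] {f : E → ℝ} (hf : MemLp f 2 ν) (hf0 : ∫ x, f x ∂ν = 0)
    {s : ℕ} (t : Fin s → ℝ) :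
    ∫ x, (∑ j, t j * f (x j)) ^ 2 ∂(Measure.pi fun _ : Fin s => ν)
      = (∑ j, t j ^ 2) * ∫ x, f x ^ 2 ∂ν := by
  have hL : ∀ j, MemLp (fun x : Fin s → E => t j * f (x j)) 2 (Measure.pi fun _ : Fin s => ν) :=
    fun j => (hf.comp_measurePreserving (measurePreserving_eval (fun _ : Fin s => ν) j)).const_mul
      (t j)
  have hv := ProbabilityTheory.variance_sum_pi (μ := fun _ : Fin s => ν)
    (X := fun j x => t j * f x) fun j => hf.const_mul (t j)
  have hsum : (∑ j, fun x : Fin s → E => t j * f (x j)) = fun x => ∑ j, t j * f (x j) := by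
    ext x
    simp
  rw [hsum, ProbabilityTheory.variance_of_integral_eq_zero] at hv
  · rw [hv, Finset.sum_mul]
    refine Finset.sum_congr rfl fun j _ => ?_
    rw [ProbabilityTheory.variance_const_mul,
      ProbabilityTheory.variance_of_integral_eq_zero hf.aestronglyMeasurable.aemeasurable hf0]
  · exact (memLp_finsetSum _ fun j _ => hL j).aestronglyMeasurable.aemeasurable
  · rw [integral_finsetSum _ fun j _ => (hL j).integrable one_le_two]
    refine Finset.sum_eq_zero fun j _ => ?_
    rw [integral_const_mul, integral_comp_eval (μ := fun _ : Fin s => ν)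
      hf.aestronglyMeasurable, hf0, mul_zero]

lemma sq_integral_le_integral_sq {Ω : Type*} [MeasurableSpace Ω] {μ : Measure Ω}
    [IsProbabilityMeasure μ] {f : Ω → ℝ} (hf : MemLp f 2 μ) :
    (∫ x, f x ∂μ) ^ 2 ≤ ∫ x, f x ^ 2 ∂μ := by
  have h := ProbabilityTheory.variance_eq_sub hf
  have := ProbabilityTheory.variance_nonneg f μ
  simp only [Pi.pow_apply] at h
  linarith

namespace IsSymmConvexBody

variable {n : ℕ} {K : Set (EuclideanSpace ℝ (Fin n))}

lemma volume_ne_zero (hK : IsSymmConvexBody K) : volume K ≠ 0 :=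
  (Measure.measure_pos_of_nonempty_interior _ hK.2.2.1).ne'

lemma pi_cond_eq (hK : IsSymmConvexBody K) (s : ℕ) :
    (Measure.pi fun _ : Fin s => ProbabilityTheory.cond volume K)
      = ((volume K)⁻¹) ^ s • volume.restrict (Set.univ.pi fun _ : Fin s => K) := by
  have := ProbabilityTheory.cond_isProbabilityMeasure_of_finite hK.volume_ne_zero
    hK.2.1.measure_lt_top.ne
  refine Measure.pi_eq fun A _ => ?_
  rw [volume_pi, Measure.restrict_pi_pi, Measure.smul_apply, Measure.pi_pi, smul_eq_mul]
  simp [ProbabilityTheory.cond, Finset.prod_mul_distrib]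

lemma integrable_pi_cond (hK : IsSymmConvexBody K) {s : ℕ}
    {F : (Fin s → EuclideanSpace ℝ (Fin n)) → ℝ} (hF : Continuous F) :
    Integrable F (Measure.pi fun _ : Fin s => ProbabilityTheory.cond volume K) := by
  rw [hK.pi_cond_eq]
  exact (hF.continuousOn.integrableOn_compact (isCompact_univ_pi fun _ => hK.2.1)).smul_measure
    (ENNReal.pow_ne_top (ENNReal.inv_ne_top.2 hK.volume_ne_zero))

lemma integrable_cond (hK : IsSymmConvexBody K) {f : EuclideanSpace ℝ (Fin n) → ℝ}
    (hf : Continuous f) : Integrable f (ProbabilityTheory.cond volume K) :=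
  (hK.integrableOn_of_continuous hf).smul_measure (ENNReal.inv_ne_top.2 hK.volume_ne_zero)

lemma integral_cond_clm_eq_zero (hK : IsSymmConvexBody K)
    (u : EuclideanSpace ℝ (Fin n) →L[ℝ] ℝ) :
    ∫ x, u x ∂(ProbabilityTheory.cond volume K) = 0 := by
  have h : ∫ x in K, u x = ∫ x in K, -u x := by
    have h1 := (Measure.measurePreserving_neg
      (volume : Measure (EuclideanSpace ℝ (Fin n)))).setIntegral_preimage_emb
      (MeasurableEquiv.neg _).measurableEmbedding u K
    rw [← h1]
    have : Neg.neg ⁻¹' K = K := by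
      ext x
      exact ⟨fun hx => by simpa using hK.neg_mem hx, fun hx => hK.neg_mem hx⟩
    simp [this]
  rw [integral_neg] at h
  rw [ProbabilityTheory.cond, integral_smul_measure]
  have : ∫ x in K, u x = 0 := by linarith
  simp [this]

lemma integral_cond_sq_le (hK : IsSymmConvexBody K) (hn : 0 < n) {α : ℝ} (hα : 0 < α)
    (hK2 : IsTwoConvex K α) {u : EuclideanSpace ℝ (Fin n) →L[ℝ] ℝ} {b : ℝ} (hb : 0 < b)
    (hu : ∀ x ∈ K, u x ≤ b) :
    ∫ x, u x ^ 2 ∂(ProbabilityTheory.cond volume K) ≤ 1 / (2 * α * n) * b ^ 2 := by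
  have hV : 0 < volume.real K :=
    ENNReal.toReal_pos hK.volume_ne_zero hK.2.1.measure_lt_top.ne
  rw [ProbabilityTheory.cond, integral_smul_measure, ENNReal.toReal_inv, smul_eq_mul,
    ← measureReal_def, inv_mul_le_iff₀ hV, mul_comm]
  exact hK.setIntegral_sq_le hn hα hK2 hb hu

lemma integral_cond_sq_pos (hK : IsSymmConvexBody K) {u : EuclideanSpace ℝ (Fin n) →L[ℝ] ℝ}
    (hu : u ≠ 0) : 0 < ∫ x, u x ^ 2 ∂(ProbabilityTheory.cond volume K) := by
  have hV : 0 < volume.real K :=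
    ENNReal.toReal_pos hK.volume_ne_zero hK.2.1.measure_lt_top.ne
  rw [ProbabilityTheory.cond, integral_smul_measure, ENNReal.toReal_inv, smul_eq_mul]
  refine mul_pos (inv_pos.2 hV) ((setIntegral_nonneg_of_ae (.of_forall fun x =>
    sq_nonneg (u x))).lt_of_ne fun h => hu ?_)
  have hae := (setIntegral_eq_zero_iff_of_nonneg_ae (.of_forall fun x => sq_nonneg (u x))
    (hK.integrableOn_of_continuous (by fun_prop))).1 h.symm
  have heq := Measure.eqOn_open_of_ae_eq (U := interior K)
    (ae_restrict_of_ae_restrict_of_subset interior_subset hae) isOpen_interior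
    (by fun_prop) continuousOn_const
  have h0 : interior K ∈ nhds 0 := interior_mem_nhds.2 hK.mem_nhds_zero_s8
  have hker : (LinearMap.ker (u : EuclideanSpace ℝ (Fin n) →ₗ[ℝ] ℝ)) = ⊤ := by
    refine Submodule.eq_top_of_nonempty_interior' _ ⟨0, ?_⟩
    refine mem_interior_iff_mem_nhds.2 (Filter.mem_of_superset h0 fun x hx => ?_)
    have := heq hx
    simpa using this
  ext x
  have : x ∈ LinearMap.ker (u : EuclideanSpace ℝ (Fin n) →ₗ[ℝ] ℝ) := hker ▸ Submodule.mem_top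
  simpa using this

/-- The covariance form of the uniform probability measure on `K`. -/
def covForm (hK : IsSymmConvexBody K) : LinearMap.BilinForm ℝ (EuclideanSpace ℝ (Fin n)) :=
  LinearMap.mk₂ ℝ
    (fun v w => ∫ x, innerSL ℝ v x * innerSL ℝ w x ∂(ProbabilityTheory.cond volume K))
    (fun v v' w => by
      simp only [map_add, add_apply, add_mul]
      exact integral_add (hK.integrable_cond (by fun_prop)) (hK.integrable_cond (by fun_prop)))
    (fun c v w => by
      simp only [map_smul, smul_apply, smul_eq_mul, mul_assoc]
      exact integral_const_mul _ _)
    (fun v w w' => by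
      simp only [map_add, add_apply, mul_add]
      exact integral_add (hK.integrable_cond (by fun_prop)) (hK.integrable_cond (by fun_prop)))
    (fun c v w => by
      simp only [map_smul, smul_apply, smul_eq_mul, mul_left_comm _ c]
      exact integral_const_mul _ _)

lemma covForm_self (hK : IsSymmConvexBody K) (v : EuclideanSpace ℝ (Fin n)) :
    hK.covForm v v = ∫ x, innerSL ℝ v x ^ 2 ∂(ProbabilityTheory.cond volume K) := by
  simp only [covForm, LinearMap.mk₂_apply, sq]

lemma covForm_self_pos (hK : IsSymmConvexBody K) {v : EuclideanSpace ℝ (Fin n)} (hv : v ≠ 0) :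
    0 < hK.covForm v v := by
  rw [covForm_self]
  refine hK.integral_cond_sq_pos fun h => hv ?_
  have := congrArg (fun u => u v) h
  simpa using this

/-- The gauge is controlled by the dual of the covariance form, written in an orthogonal basis. -/
lemma gauge_sq_le (hK : IsSymmConvexBody K) {D : ℝ} (hD : 0 ≤ D)
    (hcov : ∀ (v : EuclideanSpace ℝ (Fin n)) (b : ℝ), 0 < b → (∀ x ∈ K, innerSL ℝ v x ≤ b) →
      hK.covForm v v ≤ D * b ^ 2)
    {ι : Type*} [Fintype ι] (v : Module.Basis ι ℝ (EuclideanSpace ℝ (Fin n)))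
    (hv : hK.covForm.IsOrthoᵢ v) (y : EuclideanSpace ℝ (Fin n)) :
    gauge K y ^ 2 ≤ D * ∑ i, innerSL ℝ (v i) y ^ 2 / hK.covForm (v i) (v i) := by
  set S := ∑ i, innerSL ℝ (v i) y ^ 2 / hK.covForm (v i) (v i) with hS
  have hpos : ∀ i, 0 < hK.covForm (v i) (v i) := fun i => hK.covForm_self_pos (v.ne_zero i)
  have hS0 : 0 ≤ S := Finset.sum_nonneg fun i _ => div_nonneg (sq_nonneg _) (hpos i).le
  have hcs : ∀ w, innerSL ℝ w y ^ 2 ≤ hK.covForm w w * S := by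
    intro w
    have hw := v.sum_repr w
    have e1 : innerSL ℝ w y = ∑ i, v.repr w i * innerSL ℝ (v i) y := by
      conv_lhs => rw [← hw]
      simp only [map_sum, map_smul, sum_apply, smul_apply, smul_eq_mul]
    have e2 : hK.covForm w w = ∑ i, v.repr w i ^ 2 * hK.covForm (v i) (v i) := by
      conv_lhs => rw [← hw]
      simp only [map_sum, LinearMap.sum_apply, map_smul, LinearMap.smul_apply, smul_eq_mul]
      refine Finset.sum_congr rfl fun i _ => ?_
      rw [Finset.sum_eq_single i]
      · ring
      · intro j _ hj
        have : hK.covForm (v j) (v i) = 0 := hv hj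
        simp [this]
      · simp
    rw [e1, e2, hS]
    refine Finset.sum_sq_le_sum_mul_sum_of_sq_le_mul _
      (fun i _ => mul_nonneg (sq_nonneg _) (hpos i).le)
      (fun i _ => div_nonneg (sq_nonneg _) (hpos i).le) fun i _ => le_of_eq ?_
    have := (hpos i).ne'
    field_simp
  by_contra! hlt
  obtain ⟨ρ, hρ1, hρ2⟩ := exists_between ((Real.sqrt_lt' (lt_of_pow_lt_pow_left₀ 2
    (gauge_nonneg y) (by rw [zero_pow two_ne_zero]; exact (mul_nonneg hD hS0).trans_lt hlt))).2 hlt)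
  have hρ0 : 0 < ρ := (Real.sqrt_nonneg _).trans_lt hρ1
  have hy : y ∉ ρ • K := fun h => hρ2.not_ge (gauge_le_of_mem hρ0.le h)
  obtain ⟨f, c, hfc, hcy⟩ := geometric_hahn_banach_closed_point (hK.1.smul ρ)
    (hK.2.1.smul ρ).isClosed hy
  have h0 : (0 : EuclideanSpace ℝ (Fin n)) ∈ ρ • K :=
    ⟨0, mem_of_mem_nhds hK.mem_nhds_zero_s8, smul_zero ρ⟩
  have hc0 : 0 < c := by simpa using hfc 0 h0
  set w := (InnerProductSpace.toDual ℝ (EuclideanSpace ℝ (Fin n))).symm f with hwdef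
  have hwf : ∀ x, innerSL ℝ w x = f x := fun x => by
    rw [innerSL_apply_apply, hwdef, InnerProductSpace.toDual_symm_apply]
  have h1 := hcov w (c / ρ) (by positivity) fun x hx => by
    rw [hwf, le_div_iff₀ hρ0, mul_comm]
    simpa using (hfc (ρ • x) (Set.smul_mem_smul_set hx)).le
  have h2 := hcs w
  rw [hwf] at h2
  have h3 : c ^ 2 < D * (c / ρ) ^ 2 * S :=
    calc c ^ 2 < f y ^ 2 := by gcongr
      _ ≤ _ := h2.trans (mul_le_mul_of_nonneg_right h1 hS0)
  have h4 : D * S < ρ ^ 2 := (Real.sqrt_lt' hρ0).1 hρ1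
  have h5 : D * (c / ρ) ^ 2 * S = c ^ 2 * (D * S / ρ ^ 2) := by
    field_simp
  rw [h5] at h3
  have h6 : D * S / ρ ^ 2 < 1 := (div_lt_one (by positivity)).2 h4
  nlinarith [sq_nonneg c]

lemma integral_gauge_sq_le (hK : IsSymmConvexBody K) (hn : 0 < n) {α : ℝ} (hα : 0 < α)
    (hK2 : IsTwoConvex K α) {s : ℕ} (t : Fin s → ℝ) :
    ∫ x, gauge K (∑ j, t j • x j) ^ 2
        ∂(Measure.pi fun _ : Fin s => ProbabilityTheory.cond volume K)
      ≤ 1 / (2 * α) * ∑ j, t j ^ 2 := by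
  have := ProbabilityTheory.cond_isProbabilityMeasure_of_finite hK.volume_ne_zero
    hK.2.1.measure_lt_top.ne
  have hn' : (0 : ℝ) < n := by exact_mod_cast hn
  have hsymm : LinearMap.IsSymm hK.covForm := ⟨fun v w => by
    simp only [covForm, LinearMap.mk₂_apply, mul_comm, RingHom.id_apply]⟩
  obtain ⟨v, hv⟩ := LinearMap.BilinForm.exists_orthogonal_basis hsymm
  have hpos : ∀ i, 0 < hK.covForm (v i) (v i) := fun i => hK.covForm_self_pos (v.ne_zero i)
  have hgc := continuous_gauge hK.1 hK.mem_nhds_zero_s8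
  calc _ ≤ ∫ x, 1 / (2 * α * n) * ∑ i, innerSL ℝ (v i) (∑ j, t j • x j) ^ 2
              / hK.covForm (v i) (v i)
            ∂(Measure.pi fun _ : Fin s => ProbabilityTheory.cond volume K) := by
        refine integral_mono (hK.integrable_pi_cond (by fun_prop))
          (hK.integrable_pi_cond (by fun_prop)) fun x => ?_
        refine hK.gauge_sq_le (by positivity) (fun w b hb hw => ?_) v hv _
        rw [covForm_self]
        exact hK.integral_cond_sq_le hn hα hK2 hb hw
    _ = 1 / (2 * α * n) * ∑ i : Fin (Module.finrank ℝ (EuclideanSpace ℝ (Fin n))),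
          ∑ j, t j ^ 2 := by
        rw [integral_const_mul, integral_finsetSum _ fun i _ =>
          hK.integrable_pi_cond (by fun_prop)]
        congr 1
        refine Finset.sum_congr rfl fun i _ => ?_
        rw [integral_div, div_eq_iff (hpos i).ne', covForm_self]
        simp only [map_sum, map_smul, smul_eq_mul]
        refine integral_sq_sum_mul_pi ?_ (hK.integral_cond_clm_eq_zero _) t
        exact (memLp_two_iff_integrable_sq (by fun_prop)).2 (hK.integrable_cond (by fun_prop))
    _ = _ := by
        rw [Finset.sum_const, Finset.card_univ, Fintype.card_fin, finrank_euclideanSpace_fin,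
          nsmul_eq_mul]
        field_simp

lemma le_quarter_of_isTwoConvex (hK : IsSymmConvexBody K) (hn : 0 < n) {α : ℝ}
    (hK2 : IsTwoConvex K α) : α ≤ 1 / 4 := by
  have : Nonempty (Fin n) := ⟨⟨0, hn⟩⟩
  obtain ⟨x, hx⟩ := exists_ne (0 : EuclideanSpace ℝ (Fin n))
  have hg : 0 < gauge K x := (gauge_pos (absorbent_nhds_zero hK.mem_nhds_zero_s8)
    ((NormedSpace.isVonNBounded_iff ℝ).2 hK.2.1.isBounded)).2 hx
  set y := (gauge K x)⁻¹ • x with hy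
  have hy1 : gauge K y = 1 := by
    rw [hy, gauge_smul_of_nonneg (inv_nonneg.2 hg.le), smul_eq_mul, inv_mul_cancel₀ hg.ne']
  have hy2 : gauge K (-y) = 1 := by
    rw [gauge_neg (fun _ h => hK.neg_mem h), hy1]
  have h2 : gauge K (y - -y) = 2 := by
    rw [sub_neg_eq_add, ← two_smul ℝ, gauge_smul_of_nonneg zero_le_two, hy1]
    norm_num
  have := hK2 2 two_pos le_rfl y (-y) hy1.le hy2.le h2.ge
  rw [add_neg_cancel, smul_zero, gauge_zero] at this
  linarith

end IsSymmConvexBody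

/-- there is an absolute constant `c > 0` such that for every centrally
symmetric convex body `K` in `ℝⁿ` which is 2-convex with constant `α`, every `s ≥ 1`
and every `t ∈ ℝˢ`,
`(1/vol(K)^s) ∫_K⋯∫_K ‖∑ t_j x_j‖_K ≤ (c/α) ‖t‖₂`. -/
theorem stmt8 :
    ∃ c : ℝ, 0 < c ∧
      ∀ (n s : ℕ) (_hs : 1 ≤ s)
        (K : Set (EuclideanSpace ℝ (Fin n))) (_hK : IsSymmConvexBody K)
        (α : ℝ) (_hα : 0 < α) (_hK2 : IsTwoConvex K α)
        (t : Fin s → ℝ),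
        ((volume K).toReal ^ s)⁻¹
            * (∫ x in Set.univ.pi fun _ : Fin s => K, gauge K (∑ j, t j • x j))
          ≤ c / α * euclNorm t := by
  refine ⟨1, one_pos, fun n s _ K hK α hα hK2 t => ?_⟩
  have hR : 0 ≤ 1 / α * euclNorm t := mul_nonneg (by positivity) (Real.sqrt_nonneg _)
  rcases n.eq_zero_or_pos with rfl | hn
  · have : ∀ y : EuclideanSpace ℝ (Fin 0), gauge K y = 0 := fun y => by
      rw [Subsingleton.elim y 0, gauge_zero]
    simpa [this] using hR
  have := ProbabilityTheory.cond_isProbabilityMeasure_of_finite hK.volume_ne_zero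
    hK.2.1.measure_lt_top.ne
  have hgc := continuous_gauge hK.1 hK.mem_nhds_zero_s8
  have e : ((volume K).toReal ^ s)⁻¹
      * (∫ x in Set.univ.pi fun _ : Fin s => K, gauge K (∑ j, t j • x j))
      = ∫ x, gauge K (∑ j, t j • x j)
        ∂(Measure.pi fun _ : Fin s => ProbabilityTheory.cond volume K) := by
    rw [hK.pi_cond_eq, integral_smul_measure]
    simp
  rw [e]
  refine abs_le_of_sq_le_sq' ?_ hR |>.2
  have hL : MemLp (fun x : Fin s → EuclideanSpace ℝ (Fin n) => gauge K (∑ j, t j • x j)) 2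
      (Measure.pi fun _ : Fin s => ProbabilityTheory.cond volume K) :=
    (memLp_two_iff_integrable_sq (hK.integrable_pi_cond (by fun_prop)).aestronglyMeasurable).2
      (hK.integrable_pi_cond (by fun_prop))
  refine (sq_integral_le_integral_sq hL).trans ((hK.integral_gauge_sq_le hn hα hK2 t).trans ?_)
  rw [mul_pow, euclNorm, Real.sq_sqrt (Finset.sum_nonneg fun j _ => sq_nonneg _)]
  refine mul_le_mul_of_nonneg_right ?_ (Finset.sum_nonneg fun j _ => sq_nonneg _)
  have := hK.le_quarter_of_isTwoConvex hn hK2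
  rw [div_pow, one_pow, div_le_div_iff₀ (by positivity) (by positivity)]
  nlinarith
end
end
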